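/- If S is a set of positive integers almost closed under addition, then there exists a fully divergent, infinite in limit basic sequence Q such that for every sequence (x_n) with each x_n ∈ [0,1), dim_H( D_{(x_n)}(Q) ∩ RN^{I}(Q) ∩ RN^{II}(Q) ∩ N^{I}_{Ab}(Q) ∩ ⋂_{k∈S} N_k(Q) \ (N^{II}(Q) ∪ ⋃_{k∉S} N_k(Q)) ) = 1. -/

import Mathlib

open Filter MeasureTheory Finset
open scoped Topology Classical

/-- A basic sequence: a sequence of integers, each at least `2`. -/
def IsBasic (q : ℕ → ℕ) : Prop := ∀ n, 2 ≤ q n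

/-- The product `q_0 q_1 ⋯ q_{n-1}` of the first `n` terms of the basic sequence. -/
def qprod (q : ℕ → ℕ) (n : ℕ) : ℝ := ∏ i ∈ Finset.range n, (q i : ℝ)

/-- `T_{Q,n}(x) = (q_0 q_1 ⋯ q_{n-1}) x mod 1`. -/
noncomputable def TQ (q : ℕ → ℕ) (n : ℕ) (x : ℝ) : ℝ := Int.fract (qprod q n * x)

/-- The `n`-th digit `E_n` of the `Q`-Cantor series expansion of `x`
(digit positions are indexed by `0, 1, 2, …`). -/
noncomputable def qdigit (q : ℕ → ℕ) (x : ℝ) (n : ℕ) : ℕ := ⌊(q n : ℝ) * TQ q n x⌋₊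

/-- `N_n^Q(B,x)`: the number of occurrences of the block `B` starting among the first `n`
digit positions of the `Q`-Cantor series expansion of `x`. -/
noncomputable def blockCount (q : ℕ → ℕ) (x : ℝ) {k : ℕ} (B : Fin k → ℕ) (n : ℕ) : ℕ :=
  ((Finset.range n).filter fun i => ∀ j : Fin k, qdigit q x (i + (j : ℕ)) = B j).card

/-- `Q_n^{(k)} = ∑_{j<n} 1/(q_j q_{j+1} ⋯ q_{j+k-1})`. -/
noncomputable def Qsum (q : ℕ → ℕ) (k n : ℕ) : ℝ :=
  ∑ j ∈ Finset.range n, (∏ i ∈ Finset.range k, (q (j + i) : ℝ))⁻¹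

/-- `x` is `Q`-normal of order `k`: every block of length `k` occurs with the expected
asymptotic frequency. -/
def QNormalOfOrder (q : ℕ → ℕ) (k : ℕ) (x : ℝ) : Prop :=
  ∀ B : Fin k → ℕ,
    Tendsto (fun n => (blockCount q x B n : ℝ) / Qsum q k n) atTop (𝓝 1)

/-- `x ∈ N(Q)`: `x` is `Q`-normal of every order `k ≥ 1`. -/
def QNormal (q : ℕ → ℕ) (x : ℝ) : Prop := ∀ k, 1 ≤ k → QNormalOfOrder q k x

/-- `Q` is fully divergent: `Q_n^{(k)} → ∞` for every `k ≥ 1`. -/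
def FullyDivergent (q : ℕ → ℕ) : Prop :=
  ∀ k, 1 ≤ k → Tendsto (fun n => Qsum q k n) atTop atTop

/-- `Q` is infinite in limit: `q_n → ∞`. -/
def InfiniteInLimit (q : ℕ → ℕ) : Prop := Tendsto q atTop atTop

/-- `N_{n,m,r}^Q(B,x)`: occurrences of the block `B` (of length `m`) starting at
positions `i < n` with `i ≡ r (mod m)`. -/
noncomputable def apCount (q : ℕ → ℕ) (x : ℝ) (m r : ℕ) (B : Fin m → ℕ) (n : ℕ) : ℕ :=
  ((Finset.range n).filter fun i =>
    i % m = r ∧ ∀ j : Fin m, qdigit q x (i + (j : ℕ)) = B j).card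

/-- `Q_n^{(m,r)} = ∑_{j=0}^{⌊(n-r)/m⌋} 1/(q_{mj+r} q_{mj+r+1} ⋯ q_{mj+r+m-1})`. -/
noncomputable def apQsum (q : ℕ → ℕ) (m r n : ℕ) : ℝ :=
  ∑ j ∈ Finset.range ((n - r) / m + 1),
    (∏ i ∈ Finset.range m, (q (m * j + r + i) : ℝ))⁻¹

/-- `x ∈ N^{I}_{m,r}(Q)`. -/
def MemNAPI (q : ℕ → ℕ) (m r : ℕ) (x : ℝ) : Prop :=
  ∀ B : Fin m → ℕ,
    Tendsto (fun n => (apCount q x m r B n : ℝ) / apQsum q m r n) atTop (𝓝 1)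

/-- `x ∈ N^{I}_{Ab}(Q)`: `x` is AP `Q`-abnormal of type I. -/
def APAbnormalI (q : ℕ → ℕ) (x : ℝ) : Prop :=
  ∀ m, 2 ≤ m → ∀ r, r < m → ¬ MemNAPI q m r x

/-- `x ∈ RN^{I}(Q)`. -/
def MemRNI (q : ℕ → ℕ) (x : ℝ) : Prop :=
  ∀ m, 1 ≤ m → ∀ r, r < m → ∀ B₁ B₂ : Fin m → ℕ,
    Tendsto (fun n => (apCount q x m r B₁ n : ℝ) / (apCount q x m r B₂ n : ℝ))
      atTop (𝓝 1)

/-- `Λ_{m,r}(Q) = (q_{mt+r})_t`. -/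
def lamQ (q : ℕ → ℕ) (m r : ℕ) : ℕ → ℕ := fun t => q (m * t + r)

/-- `Υ_{Q,m,r}(x)`: the real number whose `Λ_{m,r}(Q)`-Cantor series digits are
`(E_{mt+r})_t`, where `(E_n)` are the `Q`-Cantor series digits of `x`. -/
noncomputable def Ups (q : ℕ → ℕ) (m r : ℕ) (x : ℝ) : ℝ :=
  ∑' t : ℕ, (qdigit q x (m * t + r) : ℝ) / ∏ i ∈ Finset.range (t + 1), (lamQ q m r i : ℝ)

/-- `x ∈ N^{II}_{k,m,r}(Q) = Υ_{Q,m,r}^{-1}(N_k(Λ_{m,r}(Q)))`. -/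
def MemNAPII (q : ℕ → ℕ) (k m r : ℕ) (x : ℝ) : Prop :=
  QNormalOfOrder (lamQ q m r) k (Ups q m r x)

/-- `x ∈ N^{II}(Q)`: `x` is AP `Q`-normal of type II. -/
def APNormalII (q : ℕ → ℕ) (x : ℝ) : Prop :=
  ∀ k, 1 ≤ k → ∀ m, 1 ≤ m → ∀ r, r < m → MemNAPII q k m r x

/-- `x ∈ RN^{II}(Q)`: for all `k, m, r` the counts in `Υ_{Q,m,r}(x)` of any two blocks of
length `k` with respect to `Λ_{m,r}(Q)` have ratio tending to `1`. -/
def MemRNII (q : ℕ → ℕ) (x : ℝ) : Prop :=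
  ∀ k, 1 ≤ k → ∀ m, 1 ≤ m → ∀ r, r < m → ∀ B₁ B₂ : Fin k → ℕ,
    Tendsto (fun n =>
      (blockCount (lamQ q m r) (Ups q m r x) B₁ n : ℝ) /
      (blockCount (lamQ q m r) (Ups q m r x) B₂ n : ℝ)) atTop (𝓝 1)

/-- `S` (a set of positive integers) is almost closed under addition: for every `k ∈ S`,
the set `{x ∉ S : x + k ∈ S}` has asymptotic density `0`. -/
def AlmostClosed (S : Set ℕ) : Prop :=
  ∀ k ∈ S, Tendsto
    (fun t : ℕ => (((Finset.Icc 1 t).filter fun x => x ∉ S ∧ x + k ∈ S).card : ℝ) / t)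
    atTop (𝓝 0)

/-- The sequence `u` of reals is uniformly distributed mod 1. -/
def UDMod1 (u : ℕ → ℝ) : Prop :=
  ∀ a b : ℝ, 0 ≤ a → a < b → b ≤ 1 →
    Tendsto (fun N => (((Finset.range N).filter fun n => u n ∈ Set.Ico a b).card : ℝ) / N)
      atTop (𝓝 (b - a))

/-- `x ∈ DN(Q)`: `x` is `Q`-distribution normal. -/
def DistNormal (q : ℕ → ℕ) (x : ℝ) : Prop := UDMod1 fun n => TQ q n x

/-- `x ∈ DN_{Ab}(Q)`: `x` is AP `Q`-distribution abnormal. -/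
def APDistAbnormal (q : ℕ → ℕ) (x : ℝ) : Prop :=
  ∀ m, 2 ≤ m → ∀ r, r < m → ¬ UDMod1 fun n => TQ q (m * n + r) x

/-- `y ∈ D_{(x_n)}(Q)`: for every `ξ ∈ (0,1)`, the proportion of `n ≤ N` with
`fract (T_{Q,n}(y) - x_n) < ξ` tends to `1`. -/
def MemD (q : ℕ → ℕ) (xs : ℕ → ℝ) (y : ℝ) : Prop :=
  ∀ ξ : ℝ, 0 < ξ → ξ < 1 →
    Tendsto (fun N =>
      (((Finset.range N).filter fun n => Int.fract (TQ q n y - xs n) < ξ).card : ℝ) / N)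
      atTop (𝓝 1)

/-- A computable real number. -/
def ComputableReal (x : ℝ) : Prop :=
  ∃ f : ℕ → ℕ, Computable f ∧ ∀ n : ℕ, 0 < n → (f n : ℝ) / n ≤ x ∧ x ≤ ((f n : ℝ) + 1) / n

/-- The indicator function `1_{ℕ∖S}` of the complement of `S`, with values in `ℤ`. -/
noncomputable def indZ (S : Set ℕ) (i : ℕ) : ℤ := if i ∈ S then 0 else 1

/-- The indicator function `1_{ℕ∖S}` of the complement of `S`, with values in `ℝ`. -/
noncomputable def indR (S : Set ℕ) (i : ℕ) : ℝ := if i ∈ S then 0 else 1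

/-- The coefficients `c_{t,i}`: `c_{t,1} = t (1+ε)^{1_{ℕ∖S}(1)}` and
`c_{t,i} = (1+ε)^{1_{ℕ∖S}(i) - 1_{ℕ∖S}(i-1)}` for `i ≥ 2`. -/
noncomputable def coeff (S : Set ℕ) (ε : ℝ) (t i : ℕ) : ℝ :=
  if i = 1 then (t : ℝ) * (1 + ε) ^ indZ S 1
  else (1 + ε) ^ (indZ S i - indZ S (i - 1))

/-- `N_k(b)`: the set of real numbers normal of order `k` in base `b`. -/
def BaseNormalOfOrder (b k : ℕ) : Set ℝ :=
  {x | ∀ B : Fin k → ℕ, (∀ j, B j < b) →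
    Tendsto (fun n => (blockCount (fun _ => b) x B n : ℝ) / n) atTop
      (𝓝 (((b : ℝ) ^ k)⁻¹))}

namespace CantorConstruction

/-- Alphabet size, and maximal word length, of stage `t`. -/
def alph (t : ℕ) : ℕ := t + 2

/-- Cell length of stage `t`: a multiple of every positive integer up to `alph t`. -/
def cell (t : ℕ) : ℕ := (alph t).factorial * alph t ^ 2

def expo (t : ℕ) : ℕ := 2 * cell t * alph t ^ 3

/-- Number of admissible values of a free digit at stage `t`. -/
def wid (t : ℕ) : ℕ := 2 ^ expo t

/-- The value of the basic sequence on stage `t`. -/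
def base (t : ℕ) : ℕ := expo t * wid t

/-- Length of a period of stage `t`. -/
def plen (t : ℕ) : ℕ := cell t * base t ^ alph t

/-- The stage of the `u`-th period; it grows so slowly that one period of the current stage
is negligible compared with the number of preceding periods. -/
def stage (u : ℕ) : ℕ := Nat.findGreatest (fun t => t * (plen t * base t) ≤ u) u

/-- Starting position of the `u`-th period. -/
def start (u : ℕ) : ℕ := ∑ v ∈ range u, plen (stage v)

/-- Index of the period containing position `n`. -/
def per (n : ℕ) : ℕ := Nat.findGreatest (fun u => start u ≤ n) n

/-- The stage of position `n`. -/
def st (n : ℕ) : ℕ := stage (per n)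

/-- The basic sequence. -/
def Qs (n : ℕ) : ℕ := base (st n)

lemma two_le_alph (t : ℕ) : 2 ≤ alph t := Nat.le_add_left 2 t

lemma alph_mono : Monotone alph := fun a b h => by unfold alph; omega

lemma cell_mono : Monotone cell := fun a b h => by
  unfold cell
  exact Nat.mul_le_mul (Nat.factorial_le (alph_mono h)) (Nat.pow_le_pow_left (alph_mono h) 2)

lemma expo_mono : Monotone expo := fun a b h => by
  unfold expo
  exact Nat.mul_le_mul (Nat.mul_le_mul le_rfl (cell_mono h)) (Nat.pow_le_pow_left (alph_mono h) 3)

lemma wid_mono : Monotone wid := fun a b h => by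
  unfold wid
  exact Nat.pow_le_pow_right (by norm_num) (expo_mono h)

lemma base_mono : Monotone base := fun a b h => by
  unfold base
  exact Nat.mul_le_mul (expo_mono h) (wid_mono h)

lemma alph_sq_le_cell (t : ℕ) : alph t ^ 2 ≤ cell t :=
  Nat.le_mul_of_pos_left _ (Nat.factorial_pos _)

lemma cell_pos (t : ℕ) : 0 < cell t :=
  lt_of_lt_of_le (by have := two_le_alph t; positivity) (alph_sq_le_cell t)

lemma two_mul_alph_le_cell (t : ℕ) : 2 * alph t ≤ cell t := by
  have h1 := two_le_alph t
  have h2 := alph_sq_le_cell t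
  nlinarith

lemma dvd_cell {t m : ℕ} (hm : 0 < m) (h : m ≤ alph t) : m ∣ cell t :=
  (Nat.dvd_factorial hm h).mul_right _

lemma alph_le_expo (t : ℕ) : 16 * alph t ≤ expo t := by
  have h1 := two_le_alph t
  have h2 := two_mul_alph_le_cell t
  have h3 : 2 ^ 3 ≤ alph t ^ 3 := Nat.pow_le_pow_left h1 3
  unfold expo
  nlinarith

lemma expo_le_wid (t : ℕ) : expo t ≤ wid t := Nat.lt_two_pow_self.le

lemma wid_pos (t : ℕ) : 0 < wid t := by unfold wid; positivity

lemma alph_le_wid (t : ℕ) : 16 * alph t ≤ wid t := (alph_le_expo t).trans (expo_le_wid t)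

lemma wid_le_base (t : ℕ) : 32 * wid t ≤ base t := by
  unfold base
  have := alph_le_expo t
  have := two_le_alph t
  exact Nat.mul_le_mul (by omega) le_rfl

lemma base_pos (t : ℕ) : 0 < base t := by
  have := wid_le_base t; have := wid_pos t; omega

lemma two_le_base (t : ℕ) : 2 ≤ base t := by
  have := wid_le_base t; have := wid_pos t; omega

lemma expo_le_base (t : ℕ) : expo t ≤ base t := Nat.le_mul_of_pos_right _ (wid_pos t)

lemma alph_le_base (t : ℕ) : 16 * alph t ≤ base t := (alph_le_expo t).trans (expo_le_base t)

lemma plen_pos (t : ℕ) : 0 < plen t :=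
  Nat.mul_pos (cell_pos t) (pow_pos (base_pos t) _)

lemma stage_mul_le (u : ℕ) : stage u * (plen (stage u) * base (stage u)) ≤ u :=
  Nat.findGreatest_spec (P := fun t => t * (plen t * base t) ≤ u) (Nat.zero_le u) (by simp)

lemma stage_mono : Monotone stage := fun _ _ h =>
  Nat.findGreatest_mono (fun _ h' => le_trans h' h) h

lemma tendsto_stage : Tendsto stage atTop atTop := by
  refine tendsto_atTop.2 fun T => ?_
  filter_upwards [eventually_ge_atTop (max T (T * (plen T * base T)))] with u hu
  exact Nat.le_findGreatest (le_trans (le_max_left _ _) hu) (le_trans (le_max_right _ _) hu)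

lemma start_succ (u : ℕ) : start (u + 1) = start u + plen (stage u) := sum_range_succ _ _

lemma start_strictMono : StrictMono start :=
  strictMono_nat_of_lt_succ fun u => by rw [start_succ]; have := plen_pos (stage u); omega

lemma start_zero : start 0 = 0 := rfl

lemma start_per_le (n : ℕ) : start (per n) ≤ n :=
  Nat.findGreatest_spec (P := fun u => start u ≤ n) (Nat.zero_le n) (by simp [start_zero])

lemma lt_start_per_succ (n : ℕ) : n < start (per n + 1) := by
  by_contra! h
  have h1 : per n + 1 ≤ n := (start_strictMono.le_apply).trans h
  have := Nat.le_findGreatest (P := fun u => start u ≤ n) h1 h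
  change per n + 1 ≤ per n at this
  omega

lemma per_eq {n u : ℕ} (h1 : start u ≤ n) (h2 : n < start (u + 1)) : per n = u := by
  have h3 := start_per_le n
  have h4 := lt_start_per_succ n
  have := start_strictMono.lt_iff_lt.1 (h1.trans_lt h4)
  have := start_strictMono.lt_iff_lt.1 (h3.trans_lt h2)
  omega

lemma per_start_add {u o : ℕ} (ho : o < plen (stage u)) : per (start u + o) = u :=
  per_eq (Nat.le_add_right _ _) (by rw [start_succ]; omega)

lemma per_mono : Monotone per := fun a b h => by
  have h3 := start_per_le a
  have h4 := lt_start_per_succ b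
  have := start_strictMono.lt_iff_lt.1 ((h3.trans h).trans_lt h4)
  omega

lemma tendsto_per : Tendsto per atTop atTop := by
  refine tendsto_atTop.2 fun u => ?_
  filter_upwards [eventually_ge_atTop (start u)] with n hn
  have := start_strictMono.lt_iff_lt.1 (hn.trans_lt (lt_start_per_succ n))
  omega

lemma st_mono : Monotone st := stage_mono.comp per_mono

lemma tendsto_st : Tendsto st atTop atTop := tendsto_stage.comp tendsto_per

lemma st_start_add {u o : ℕ} (ho : o < plen (stage u)) : st (start u + o) = stage u := by
  rw [st, per_start_add ho]

lemma Qs_mono : Monotone Qs := base_mono.comp st_mono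

lemma Qs_basic : IsBasic Qs := fun _ => two_le_base _

lemma le_base (t : ℕ) : t ≤ base t := by
  have := alph_le_base t
  unfold alph at this; omega

lemma tendsto_Qs : Tendsto Qs atTop atTop :=
  tendsto_atTop_mono (fun n => le_base (st n)) tendsto_st

/-- The sum of `f` over the `u`-th period. -/
noncomputable def psum (f : ℕ → ℝ) (u : ℕ) : ℝ :=
  ∑ o ∈ range (plen (stage u)), f (start u + o)

lemma sum_range_start (f : ℕ → ℝ) (u : ℕ) :
    ∑ i ∈ range (start u), f i = ∑ v ∈ range u, psum f v := by
  induction u with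
  | zero => simp [start_zero]
  | succ u ih => rw [start_succ, sum_range_add, ih, sum_range_succ]; rfl

/-- Nonnegative functions bounded by the basic sequence. -/
def Adm (f : ℕ → ℝ) : Prop := ∀ n, 0 ≤ f n ∧ f n ≤ Qs n

lemma sum_sub_start {f : ℕ → ℝ} (hf : Adm f) (n : ℕ) :
    0 ≤ ∑ i ∈ range n, f i - ∑ v ∈ range (per n), psum f v ∧
      ∑ i ∈ range n, f i - ∑ v ∈ range (per n), psum f v
        ≤ (plen (st n) * base (st n) : ℕ) := by
  obtain ⟨o, ho⟩ := Nat.exists_eq_add_of_le (start_per_le n)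
  have ho' : o < plen (st n) := by
    have := lt_start_per_succ n
    rw [start_succ, ← st] at this
    omega
  rw [← sum_range_start]
  have hs : ∑ i ∈ range n, f i - ∑ i ∈ range (start (per n)), f i
      = ∑ x ∈ range o, f (start (per n) + x) := by
    conv_lhs => rw [ho, sum_range_add]
    rw [← ho]; ring
  rw [hs]
  refine ⟨sum_nonneg fun i _ => (hf _).1, ?_⟩
  have : ∀ x ∈ range o, f (start (per n) + x) ≤ (base (st n) : ℝ) := by
    intro x hx
    have hx' : x < plen (stage (per n)) := (mem_range.1 hx).trans ho'
    have := (hf (start (per n) + x)).2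
    rwa [Qs, st_start_add hx'] at this
  refine (sum_le_sum this).trans ?_
  rw [sum_const, card_range, nsmul_eq_mul]
  push_cast
  gcongr

lemma stage_mul_le_real (n : ℕ) :
    (st n : ℝ) * (plen (st n) * base (st n) : ℕ) ≤ per n := by
  exact_mod_cast stage_mul_le (per n)

lemma partial_isLittleO : (fun n => ((plen (st n) * base (st n) : ℕ) : ℝ))
    =o[atTop] fun n => (per n : ℝ) := by
  refine Asymptotics.isLittleO_iff.2 fun c hc => ?_
  obtain ⟨T, hT⟩ := exists_nat_gt c⁻¹
  filter_upwards [tendsto_st.eventually_ge_atTop T] with n hn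
  rw [Real.norm_natCast, Real.norm_natCast]
  have h1 := stage_mul_le_real n
  have h2 : c⁻¹ ≤ st n := hT.le.trans (by exact_mod_cast hn)
  have h3 : c⁻¹ * (plen (st n) * base (st n) : ℕ) ≤ per n :=
    (mul_le_mul_of_nonneg_right h2 (Nat.cast_nonneg _)).trans h1
  rwa [inv_mul_le_iff₀ hc] at h3

section ratio

variable {f g : ℕ → ℝ} (hf : Adm f) (hg : Adm g) (hG : ∀ᶠ u in atTop, 1 ≤ psum g u)

include hg hG

lemma exists_per_le : ∃ C : ℝ, ∀ n, (per n : ℝ) - C ≤ ∑ v ∈ range (per n), psum g v := by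
  obtain ⟨u₀, h₀⟩ := eventually_atTop.1 hG
  refine ⟨u₀, fun n => ?_⟩
  generalize per n = u
  have hnn : ∀ v, 0 ≤ psum g v := fun v => sum_nonneg fun i _ => (hg _).1
  induction u with
  | zero => simp
  | succ u ih =>
    rw [sum_range_succ]
    rcases le_or_gt u₀ u with h | h
    · have := h₀ u h
      push_cast; linarith
    · have h1 : ((u : ℝ) + 1) ≤ u₀ := by exact_mod_cast h
      have h2 : 0 ≤ ∑ v ∈ range u, psum g v := sum_nonneg fun v _ => hnn v
      have := hnn u
      push_cast; linarith

lemma per_isBigO : (fun n => (per n : ℝ)) =O[atTop] fun n => ∑ v ∈ range (per n), psum g v := by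
  obtain ⟨C, hC⟩ := exists_per_le hg hG
  refine Asymptotics.IsBigO.of_bound 2 ?_
  have := tendsto_natCast_atTop_atTop (R := ℝ) |>.comp tendsto_per
  filter_upwards [this.eventually_ge_atTop (2 * C)] with n hn
  have := hC n
  simp only [Function.comp] at hn
  rw [Real.norm_natCast]
  refine le_trans ?_ (mul_le_mul_of_nonneg_left (le_abs_self _) zero_le_two)
  linarith

lemma tendsto_psums : Tendsto (fun n => ∑ v ∈ range (per n), psum g v) atTop atTop := by
  obtain ⟨C, hC⟩ := exists_per_le hg hG
  refine tendsto_atTop_mono hC ?_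
  exact tendsto_atTop_add_const_right _ _ (tendsto_natCast_atTop_atTop (R := ℝ) |>.comp tendsto_per)

lemma tendsto_sum_atTop : Tendsto (fun n => ∑ i ∈ range n, g i) atTop atTop := by
  refine tendsto_atTop_mono (fun n => ?_) (tendsto_psums hg hG)
  have := (sum_sub_start hg n).1
  linarith

omit hG in
lemma psums_isBigO :
    (fun n => ∑ v ∈ range (per n), psum g v) =O[atTop] fun n => ∑ i ∈ range n, g i := by
  refine Asymptotics.IsBigO.of_bound 1 (Eventually.of_forall fun n => ?_)
  have := (sum_sub_start hg n).1
  have h0 : 0 ≤ ∑ v ∈ range (per n), psum g v :=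
    sum_nonneg fun v _ => sum_nonneg fun i _ => (hg _).1
  rw [Real.norm_of_nonneg h0, Real.norm_of_nonneg (by linarith)]
  linarith

lemma partial_isLittleO_sum : (fun n => ((plen (st n) * base (st n) : ℕ) : ℝ))
    =o[atTop] fun n => ∑ i ∈ range n, g i :=
  (partial_isLittleO.trans_isBigO (per_isBigO hg hG)).trans_isBigO (psums_isBigO hg)

include hf

lemma sum_sub_isLittleO (β : ℝ)
    (h : (fun u => psum f u - β * psum g u) =o[atTop] psum g) :
    (fun n => ∑ i ∈ range n, f i - β * ∑ i ∈ range n, g i)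
      =o[atTop] fun n => ∑ i ∈ range n, g i := by
  have hnn : ∀ v, 0 ≤ psum g v := fun v => sum_nonneg fun i _ => (hg _).1
  have hdiv : Tendsto (fun u => ∑ v ∈ range u, psum g v) atTop atTop := by
    obtain ⟨u₀, h₀⟩ := eventually_atTop.1 hG
    refine tendsto_atTop_mono' _ ?_
      ((tendsto_psums hg hG).comp start_strictMono.tendsto_atTop)
    refine Eventually.of_forall fun u => ?_
    have : per (start u) = u := by simpa using per_start_add (o := 0) (plen_pos (stage u))
    simp [this]
  have h1 := (h.sum_range hnn hdiv).comp_tendsto tendsto_per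
  have h2 : (fun n => ∑ v ∈ range (per n), (psum f v - β * psum g v))
      =o[atTop] fun n => ∑ i ∈ range n, g i := h1.trans_isBigO (psums_isBigO hg)
  have h3 : ∀ {f : ℕ → ℝ}, Adm f → (fun n => ∑ i ∈ range n, f i - ∑ v ∈ range (per n), psum f v)
      =o[atTop] fun n => ∑ i ∈ range n, g i := by
    intro f hf
    refine Asymptotics.IsBigO.trans_isLittleO ?_ (partial_isLittleO_sum hg hG)
    refine Asymptotics.IsBigO.of_bound 1 (Eventually.of_forall fun n => ?_)
    have := sum_sub_start hf n
    rw [Real.norm_of_nonneg this.1, Real.norm_natCast, one_mul]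
    exact this.2
  have h4 := ((h3 hf).sub ((h3 hg).const_mul_left β)).add h2
  refine h4.congr_left fun n => ?_
  rw [sum_sub_distrib, ← mul_sum]
  ring

lemma tendsto_ratio (β : ℝ)
    (h : (fun u => psum f u - β * psum g u) =o[atTop] psum g) :
    Tendsto (fun n => (∑ i ∈ range n, f i) / ∑ i ∈ range n, g i) atTop (𝓝 β) := by
  have h1 := (sum_sub_isLittleO hf hg hG β h).tendsto_div_nhds_zero
  have h2 := h1.add_const β
  rw [zero_add] at h2
  refine h2.congr' ?_
  filter_upwards [(tendsto_sum_atTop hg hG).eventually_gt_atTop 0] with n hn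
  field_simp
  ring

end ratio

lemma card_functions_with_values {n k a : ℕ} (p : Fin k → Fin n) (hp : Function.Injective p)
    (b : Fin k → Fin a) :
    (univ.filter fun w : Fin n → Fin a => ∀ j, w (p j) = b j).card = a ^ (n - k) := by
  have h1 : (univ.filter fun w : Fin n → Fin a => ∀ j, w (p j) = b j)
      = Fintype.piFinset fun i => univ.filter fun v : Fin a => ∀ j, p j = i → v = b j := by
    ext w
    simp only [mem_filter, mem_univ, true_and, Fintype.mem_piFinset]
    exact ⟨fun h i j hj => hj ▸ h j, fun h j => h _ j rfl⟩
  have h2 : ∀ i, (univ.filter fun v : Fin a => ∀ j, p j = i → v = b j).card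
      = if i ∈ univ.image p then 1 else a := by
    intro i
    split_ifs with hi
    · obtain ⟨j₀, -, rfl⟩ := mem_image.1 hi
      rw [card_eq_one]
      refine ⟨b j₀, ?_⟩
      ext v
      simp only [mem_filter, mem_univ, true_and, mem_singleton]
      exact ⟨fun h => h j₀ rfl, fun h j hj => by rw [h, hp hj]⟩
    · rw [filter_true_of_mem, card_univ, Fintype.card_fin]
      intro v _ j hj
      exact absurd (mem_image.2 ⟨j, mem_univ _, hj⟩) hi
  rw [h1, Fintype.card_piFinset, prod_congr rfl fun i _ => h2 i, prod_ite]
  simp only [prod_const_one, one_mul, prod_const]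
  congr 1
  have h3 : (univ.filter fun i => i ∉ univ.image p) = (univ.image p)ᶜ := by ext; simp
  rw [h3, card_compl, Fintype.card_fin, card_image_of_injective _ hp, card_univ, Fintype.card_fin]

variable (S : Set ℕ)

/-- How often each word of length `L` is written in one period of stage `t`. -/
noncomputable def mult (t L : ℕ) : ℕ := (if L ∈ S then 1 else 2) * (cell t * base t ^ (alph t - L))

/-- The words written in a period of stage `t`, with multiplicity. -/
abbrev Words (t : ℕ) : Type :=
  Σ l : Fin (alph t), (Fin (l + 1) → Fin (alph t)) × Fin (mult S t (l + 1))

lemma mult_le (t L : ℕ) : mult S t L ≤ 2 * (cell t * base t ^ (alph t - L)) := by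
  unfold mult
  gcongr
  split_ifs <;> norm_num

lemma pow_mul_pow_le {a c n l : ℕ} (hac : a ≤ c) (hl : l < n) :
    a ^ (l + 1) * c ^ (n - (l + 1)) ≤ a * c ^ (n - 1) := by
  have : n - 1 = l + (n - (l + 1)) := by omega
  calc a ^ (l + 1) * c ^ (n - (l + 1)) = a * (a ^ l * c ^ (n - (l + 1))) := by ring
    _ ≤ a * (c ^ l * c ^ (n - (l + 1))) := by gcongr
    _ = a * c ^ (n - 1) := by rw [← pow_add, ← this]

lemma card_words_le (t : ℕ) : Fintype.card (Words S t) ≤ base t ^ alph t := by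
  have hA := two_le_alph t
  rw [Fintype.card_sigma]
  have h1 : ∀ l : Fin (alph t), Fintype.card ((Fin (l + 1) → Fin (alph t)) × Fin (mult S t (l + 1)))
      ≤ 2 * cell t * (alph t * base t ^ (alph t - 1)) := by
    intro l
    rw [Fintype.card_prod, Fintype.card_fun, Fintype.card_fin, Fintype.card_fin, Fintype.card_fin]
    calc _ ≤ alph t ^ ((l : ℕ) + 1) * (2 * (cell t * base t ^ (alph t - (l + 1)))) :=
          Nat.mul_le_mul le_rfl (mult_le S t _)
      _ = 2 * cell t * (alph t ^ ((l : ℕ) + 1) * base t ^ (alph t - (l + 1))) := by ring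
      _ ≤ _ := Nat.mul_le_mul le_rfl (pow_mul_pow_le (by have := alph_le_base t; omega) l.2)
  refine (sum_le_sum fun l _ => h1 l).trans ?_
  rw [sum_const, card_univ, Fintype.card_fin, smul_eq_mul]
  have h2 : base t ^ alph t = base t * base t ^ (alph t - 1) := by
    rw [← pow_succ', Nat.sub_add_cancel (by omega)]
  rw [h2]
  calc alph t * (2 * cell t * (alph t * base t ^ (alph t - 1)))
      = (2 * cell t * alph t ^ 2) * base t ^ (alph t - 1) := by ring
    _ ≤ _ := by
        gcongr
        refine le_trans ?_ (expo_le_base t)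
        unfold expo
        gcongr <;> omega

/-- The cell in which a word is written. -/
noncomputable def place (t : ℕ) : Words S t ↪ Fin (base t ^ alph t) :=
  (Function.Embedding.nonempty_of_card_le (by simpa using card_words_le S t)).some

variable {S} in
def len {t : ℕ} (x : Words S t) : ℕ := x.1 + 1

variable {S} in
/-- The letter at position `y` of a word. -/
def letter {t : ℕ} (x : Words S t) (y : ℕ) : ℕ := if h : y < x.1 + 1 then x.2.1 ⟨y, h⟩ else 0

/-- The entry at offset `o` of a period of stage `t`; `none` stands for a free digit. -/
noncomputable def pat (t o : ℕ) : Option ℕ :=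
  if h : ∃ x : Words S t, (place S t x : ℕ) = o / cell t ∧ o % cell t < len x then
    some (letter h.choose (o % cell t)) else none

/-- The prescribed digit at position `n`; `none` stands for a free digit. -/
noncomputable def dg (n : ℕ) : Option ℕ := pat S (st n) (n - start (per n))

variable {S}

lemma len_le {t : ℕ} (x : Words S t) : len x ≤ alph t := x.1.2

lemma letter_lt {t : ℕ} (x : Words S t) (y : ℕ) : letter x y < alph t := by
  unfold letter
  split_ifs
  · exact Fin.is_lt _
  · have := two_le_alph t; omega

lemma pat_eq {t : ℕ} (x : Words S t) {y : ℕ} (hy : y < len x) :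
    pat S t (place S t x * cell t + y) = some (letter x y) := by
  have hyc : y < cell t := by
    have := len_le x; have := two_mul_alph_le_cell t; omega
  have h1 : (place S t x * cell t + y) / cell t = place S t x := by
    rw [mul_comm, Nat.mul_add_div (cell_pos t), Nat.div_eq_of_lt hyc, add_zero]
  have h2 : (place S t x * cell t + y) % cell t = y := by
    rw [mul_comm, Nat.mul_add_mod, Nat.mod_eq_of_lt hyc]
  have h : ∃ x' : Words S t, (place S t x' : ℕ) = (place S t x * cell t + y) / cell t
      ∧ (place S t x * cell t + y) % cell t < len x' := ⟨x, h1.symm, by rwa [h2]⟩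
  have hx : h.choose = x := (place S t).injective (Fin.ext (h.choose_spec.1.trans h1))
  unfold pat
  rw [dif_pos h, hx, h2]

lemma exists_of_pat {t o v : ℕ} (h : pat S t o = some v) :
    ∃ x : Words S t, ∃ y < len x, o = place S t x * cell t + y ∧ letter x y = v := by
  unfold pat at h
  split_ifs at h with hx
  obtain ⟨h1, h2⟩ := hx.choose_spec
  refine ⟨hx.choose, o % cell t, h2, ?_, by simpa using h⟩
  rw [h1, mul_comm, Nat.div_add_mod]

lemma place_add_lt {t : ℕ} (x : Words S t) {y : ℕ} (hy : y < cell t) :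
    place S t x * cell t + y < plen t := by
  have h := (place S t x).2
  calc place S t x * cell t + y < place S t x * cell t + cell t := by omega
    _ = (place S t x + 1) * cell t := by ring
    _ ≤ base t ^ alph t * cell t := Nat.mul_le_mul h le_rfl
    _ = plen t := by rw [plen, mul_comm]

lemma dg_start_add {u o : ℕ} (ho : o < plen (stage u)) :
    dg S (start u + o) = pat S (stage u) o := by
  rw [dg, st_start_add ho, per_start_add ho, Nat.add_sub_cancel_left]

variable (S) in
/-- `E` follows the prescribed digits and has large digits elsewhere. -/
def Follows (E : ℕ → ℕ) : Prop :=
  ∀ n, (∀ v, dg S n = some v → E n = v) ∧ (dg S n = none → wid (st n) ≤ E n)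

lemma Follows.dg_eq {E : ℕ → ℕ} (hE : Follows S E) {n v T : ℕ} (hv : v < wid T) (hT : T ≤ st n)
    (h : E n = v) : dg S n = some v := by
  cases hd : dg S n with
  | none =>
    have := (hE n).2 hd
    have := wid_mono hT
    omega
  | some v' => rw [← (hE n).1 v' hd, h]

/-- Occurrence of `B` at position `i ≡ r (mod m)`, read with step `s`. -/
def Occ (E : ℕ → ℕ) (s m r : ℕ) {k : ℕ} (B : Fin k → ℕ) (i : ℕ) : Prop :=
  i % m = r ∧ ∀ j : Fin k, E (i + s * (j : ℕ)) = B j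

/-- Occurrence of `B` at offset `y` inside the word `x`. -/
def OccIn {t : ℕ} (x : Words S t) (e s m r : ℕ) {k : ℕ} (B : Fin k → ℕ) (y : ℕ) : Prop :=
  (y + s * (k - 1) < len x ∧ (e + y) % m = r) ∧ ∀ j : Fin k, letter x (y + s * (j : ℕ)) = B j

section

variable {E : ℕ → ℕ} (hE : Follows S E) {u s m r k : ℕ} {B : Fin k → ℕ} (hk : 0 < k)
  (hs : s ≤ alph (stage u)) (hB : ∀ j, B j < alph (stage u)) (hm : m ∣ cell (stage u))

include hE hk hs hB hm

lemma occ_iff {o : ℕ} (ho : o < plen (stage u)) :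
    Occ E s m r B (start u + o) ↔
      ∃ x : Words S (stage u), ∃ y, OccIn x (start u) s m r B y
        ∧ o = place S (stage u) x * cell (stage u) + y := by
  have hAK := two_mul_alph_le_cell (stage u)
  have hmod : ∀ p y : ℕ, (start u + (p * cell (stage u) + y)) % m = (start u + y) % m := by
    intro p y
    obtain ⟨c, hc⟩ := hm
    rw [hc, show start u + (p * (m * c) + y) = start u + y + m * (p * c) by ring,
      Nat.add_mul_mod_self_left]
  constructor
  · rintro ⟨h1, h2⟩
    have hd : ∀ j : Fin k, dg S (start u + o + s * j) = some (B j) := fun j =>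
      hE.dg_eq (T := stage u)
        (by have := hB j; have := alph_le_wid (stage u); omega)
        (by rw [← st_start_add ho]; exact st_mono (by omega)) (h2 j)
    have h0 := hd ⟨0, hk⟩
    simp only [mul_zero, add_zero] at h0
    rw [dg_start_add ho] at h0
    obtain ⟨x, y, hy, hoy, hl⟩ := exists_of_pat h0
    have key : ∀ j (hj : j < k), y + s * j < len x ∧ letter x (y + s * j) = B ⟨j, hj⟩ := by
      intro j
      induction j with
      | zero => exact fun _ => ⟨by simpa using hy, by simpa using hl⟩
      | succ j ih =>
        intro hj
        have h3 := (ih (by omega)).1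
        have hlen := len_le x
        have h4 : y + s * (j + 1) < cell (stage u) := by rw [mul_add, mul_one]; omega
        have h5 := hd ⟨j + 1, hj⟩
        simp only at h5
        rw [hoy, add_assoc, add_assoc, dg_start_add (place_add_lt x h4)] at h5
        obtain ⟨x', y', hy', hoy', hl'⟩ := exists_of_pat h5
        have hy'c : y' < cell (stage u) := by have := len_le x'; omega
        have h6 := congrArg (· / cell (stage u)) hoy'
        have h7 := congrArg (· % cell (stage u)) hoy'
        simp only [mul_comm _ (cell (stage u)), Nat.mul_add_div (cell_pos _),
          Nat.div_eq_of_lt h4, Nat.div_eq_of_lt hy'c, add_zero] at h6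
        simp only [mul_comm _ (cell (stage u)), Nat.mul_add_mod,
          Nat.mod_eq_of_lt h4, Nat.mod_eq_of_lt hy'c] at h7
        have hxx : x = x' := (place S _).injective (Fin.ext h6)
        subst hxx
        subst h7
        exact ⟨hy', hl'⟩
    refine ⟨x, y, ⟨⟨(key (k - 1) (by omega)).1, ?_⟩, fun j => (key j j.2).2⟩, hoy⟩
    rw [← h1, hoy, hmod]
  · rintro ⟨x, y, ⟨⟨h1, h2⟩, h3⟩, rfl⟩
    refine ⟨by rw [hmod, h2], fun j => ?_⟩
    have hj : y + s * (j : ℕ) < len x :=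
      lt_of_le_of_lt (by have := j.2; gcongr; omega) h1
    have hlen := len_le x
    refine (hE _).1 _ ?_
    rw [add_assoc, add_assoc, dg_start_add (place_add_lt x (by omega)), pat_eq x hj, h3 j]

lemma card_occ : ((range (plen (stage u))).filter fun o => Occ E s m r B (start u + o)).card
    = ∑ x : Words S (stage u), ((range (len x)).filter fun y => OccIn x (start u) s m r B y).card := by
  rw [← card_sigma]
  symm
  refine card_nbij (fun p => place S (stage u) p.1 * cell (stage u) + p.2) ?_ ?_ ?_
  · rintro ⟨x, y⟩ hxy
    simp only [mem_coe, mem_sigma, mem_univ, true_and, mem_filter, mem_range] at hxy ⊢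
    have hlen := len_le x
    have hAK := two_mul_alph_le_cell (stage u)
    have ho := place_add_lt x (y := y) (by omega)
    exact ⟨ho, (occ_iff hE hk hs hB hm ho).2 ⟨x, y, hxy.2, rfl⟩⟩
  · rintro ⟨x, y⟩ hxy ⟨x', y'⟩ hxy' h
    simp only [coe_sigma, Set.mem_sigma_iff, coe_univ, Set.mem_univ, true_and, coe_filter,
      mem_range, Set.mem_ofPred_eq] at hxy hxy'
    have hlen := len_le x
    have hlen' := len_le x'
    have hAK := two_mul_alph_le_cell (stage u)
    have h4 : y < cell (stage u) := by omega
    have h4' : y' < cell (stage u) := by omega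
    have h6 := congrArg (· / cell (stage u)) h
    have h7 := congrArg (· % cell (stage u)) h
    simp only [mul_comm _ (cell (stage u)), Nat.mul_add_div (cell_pos _),
      Nat.div_eq_of_lt h4, Nat.div_eq_of_lt h4', add_zero] at h6
    simp only [mul_comm _ (cell (stage u)), Nat.mul_add_mod,
      Nat.mod_eq_of_lt h4, Nat.mod_eq_of_lt h4'] at h7
    have hxx : x = x' := (place S _).injective (Fin.ext h6)
    subst hxx
    subst h7
    rfl
  · intro o ho
    simp only [coe_filter, mem_range, Set.mem_ofPred_eq] at ho
    obtain ⟨x, y, hxy, rfl⟩ := (occ_iff hE hk hs hB hm ho.1).1 ho.2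
    refine ⟨⟨x, y⟩, ?_, rfl⟩
    simp only [coe_sigma, Set.mem_sigma_iff, coe_univ, Set.mem_univ, true_and, coe_filter,
      mem_range, Set.mem_ofPred_eq]
    exact ⟨lt_of_le_of_lt (Nat.le_add_right _ _) hxy.1.1, hxy⟩

end

/-- Admissible offsets of a block of length `k` in a word of length `L`. -/
def offsets (L e s m r k : ℕ) : Finset ℕ :=
  (range L).filter fun y => y + s * (k - 1) < L ∧ (e + y) % m = r

variable (S) in
/-- The number of occurrences of a block of length `k` in a period of stage `t` whose starting
position is `e`. -/
noncomputable def count (t e s m r k : ℕ) : ℕ :=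
  ∑ l ∈ range (alph t),
    mult S t (l + 1) * ((offsets (l + 1) e s m r k).card * alph t ^ (l + 1 - k))

lemma card_words_fixed {a l k s y : ℕ} (hk : 0 < k) (hs : 0 < s) (hy : y + s * (k - 1) < l + 1)
    (B : Fin k → ℕ) (hB : ∀ j, B j < a) :
    (univ.filter fun w : Fin (l + 1) → Fin a => ∀ j : Fin k,
      (if h : y + s * (j : ℕ) < l + 1 then (w ⟨y + s * j, h⟩ : ℕ) else 0) = B j).card
      = a ^ (l + 1 - k) := by
  have hj : ∀ j : Fin k, y + s * (j : ℕ) < l + 1 := fun j =>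
    lt_of_le_of_lt (by have := j.2; gcongr; omega) hy
  rw [← card_functions_with_values (fun j : Fin k => (⟨y + s * j, hj j⟩ : Fin (l + 1)))
    (fun i j h => ?_) (fun j => ⟨B j, hB j⟩)]
  · congr 1
    ext w
    simp only [mem_filter, mem_univ, true_and, hj, dite_true, Fin.ext_iff]
  · have := Fin.ext_iff.1 h
    simp only [Nat.add_left_cancel_iff] at this
    exact Fin.ext (Nat.eq_of_mul_eq_mul_left hs this)

lemma sum_words {t e s m r k : ℕ} (hk : 0 < k) (hs : 0 < s) {B : Fin k → ℕ}
    (hB : ∀ j, B j < alph t) :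
    ∑ x : Words S t, ((range (len x)).filter fun y => OccIn x e s m r B y).card
      = count S t e s m r k := by
  rw [Fintype.sum_sigma, count, ← Fin.sum_univ_eq_sum_range
    (fun l => mult S t (l + 1) * ((offsets (l + 1) e s m r k).card * alph t ^ (l + 1 - k)))]
  refine sum_congr rfl fun l _ => ?_
  rw [Fintype.sum_prod_type]
  have h1 : ∀ w : Fin ((l : ℕ) + 1) → Fin (alph t), ∀ c : Fin (mult S t (l + 1)),
      ((range (len (⟨l, w, c⟩ : Words S t))).filter fun y =>
        OccIn (⟨l, w, c⟩ : Words S t) e s m r B y).card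
      = ∑ y ∈ offsets (l + 1) e s m r k, if ∀ j : Fin k,
      (if h : y + s * (j : ℕ) < l + 1 then (w ⟨y + s * j, h⟩ : ℕ) else 0) = B j then 1 else 0 := by
    intro w c
    rw [← card_filter, offsets, filter_filter]
    exact congrArg card (filter_congr fun _ _ => Iff.rfl)
  simp only [h1, sum_const, card_univ, Fintype.card_fin, smul_eq_mul]
  rw [← mul_sum, sum_comm]
  congr 1
  have h2 : ∀ y ∈ offsets (l + 1) e s m r k, ∑ w : Fin ((l : ℕ) + 1) → Fin (alph t),
      (if ∀ j : Fin k, (if h : y + s * (j : ℕ) < l + 1 then (w ⟨y + s * j, h⟩ : ℕ) else 0) = B j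
        then 1 else 0) = alph t ^ ((l : ℕ) + 1 - k) := by
    intro y hy
    rw [← card_filter]
    exact card_words_fixed hk hs (mem_filter.1 hy).2.1 B hB
  rw [sum_congr rfl h2, sum_const, smul_eq_mul]

lemma count_term_le {t l k e m r : ℕ} (hl : l < alph t) (hlk : l + 1 ≠ k) :
    alph t * (mult S t (l + 1) * ((offsets (l + 1) e 1 m r k).card * alph t ^ (l + 1 - k)))
      ≤ base t ^ (alph t - k) := by
  rcases lt_or_gt_of_ne hlk with h | h
  · have : offsets (l + 1) e 1 m r k = ∅ := filter_false_of_mem fun y _ => by omega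
    simp [this]
  · have h1 : (offsets (l + 1) e 1 m r k).card ≤ alph t :=
      (card_filter_le _ _).trans (by rw [card_range]; omega)
    obtain ⟨i, hi⟩ := Nat.exists_eq_add_of_le (show k + 1 ≤ l + 1 by omega)
    have h2 : alph t ^ (i + 1) * base t ^ (alph t - k - (i + 1))
        ≤ alph t * base t ^ (alph t - k - 1) :=
      pow_mul_pow_le (by have := alph_le_base t; omega) (by omega)
    have h3 : l + 1 - k = i + 1 := by omega
    have h4 : alph t - (l + 1) = alph t - k - (i + 1) := by omega
    calc _ ≤ alph t * (2 * (cell t * base t ^ (alph t - (l + 1)))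
            * (alph t * alph t ^ (l + 1 - k))) := by
          gcongr
          exact mult_le S t _
      _ = 2 * cell t * alph t ^ 2 * (alph t ^ (i + 1) * base t ^ (alph t - k - (i + 1))) := by
          rw [h3, h4]; ring
      _ ≤ 2 * cell t * alph t ^ 2 * (alph t * base t ^ (alph t - k - 1)) := by gcongr
      _ = expo t * base t ^ (alph t - k - 1) := by unfold expo; ring
      _ ≤ base t * base t ^ (alph t - k - 1) := by gcongr; exact expo_le_base t
      _ = base t ^ (alph t - k) := by rw [← pow_succ', Nat.sub_add_cancel (by omega)]

lemma count_bounds {t k e m r : ℕ} (hk : 0 < k) (hkA : k ≤ alph t) :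
    (if e % m = r then mult S t k else 0) ≤ count S t e 1 m r k ∧
      count S t e 1 m r k ≤ (if e % m = r then mult S t k else 0) + base t ^ (alph t - k) := by
  have hmem : k - 1 ∈ range (alph t) := by rw [mem_range]; omega
  have hk1 : k - 1 + 1 = k := by omega
  have hmain : mult S t (k - 1 + 1) * ((offsets (k - 1 + 1) e 1 m r k).card
      * alph t ^ (k - 1 + 1 - k)) = if e % m = r then mult S t k else 0 := by
    have : offsets k e 1 m r k = if e % m = r then {0} else ∅ := by
      ext y
      simp only [offsets, mem_filter, mem_range]
      split_ifs with h
      · rw [mem_singleton]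
        constructor
        · omega
        · rintro rfl; exact ⟨hk, by omega, by simpa using h⟩
      · simp only [notMem_empty, iff_false]
        rintro ⟨_, h2, h3⟩
        obtain rfl : y = 0 := by omega
        exact h (by simpa using h3)
    rw [hk1, this]
    split_ifs <;> simp
  unfold count
  rw [← add_sum_erase _ _ hmem, hmain]
  refine ⟨Nat.le_add_right _ _, Nat.add_le_add_left ?_ _⟩
  have hA := two_le_alph t
  refine le_of_mul_le_mul_left (a := alph t) ?_ (by omega)
  rw [mul_sum]
  refine (sum_le_sum (g := fun _ => base t ^ (alph t - k)) fun l hl => ?_).trans ?_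
  · rw [mem_erase, mem_range] at hl
    exact count_term_le hl.2 (by omega)
  · rw [sum_const, smul_eq_mul]
    gcongr
    exact (card_erase_le).trans (by rw [card_range])

lemma one_le_count {t k e s m r : ℕ} (hr : r < m) (h : m + s * (k - 1) ≤ alph t) :
    1 ≤ count S t e s m r k := by
  have hA := two_le_alph t
  have hmem : alph t - 1 ∈ range (alph t) := by rw [mem_range]; omega
  refine le_trans ?_ (single_le_sum (fun _ _ => Nat.zero_le _) hmem)
  have h1 : alph t - 1 + 1 = alph t := by omega
  rw [h1]
  have hy : (r + m - e % m) % m ∈ offsets (alph t) e s m r k := by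
    have h2 : (r + m - e % m) % m < m := Nat.mod_lt _ (by omega)
    have h3 : e % m < m := Nat.mod_lt _ (by omega)
    simp only [offsets, mem_filter, mem_range]
    refine ⟨by omega, by omega, ?_⟩
    rw [Nat.add_mod_mod, ← Nat.mod_add_mod,
      show e % m + (r + m - e % m) = r + m by omega, Nat.add_mod_right, Nat.mod_eq_of_lt hr]
  have h4 : 0 < (offsets (alph t) e s m r k).card := card_pos.2 ⟨_, hy⟩
  have h5 : 0 < mult S t (alph t) := by
    unfold mult
    have := cell_pos t
    have := base_pos t
    split_ifs <;> positivity
  exact Nat.mul_pos h5 (Nat.mul_pos h4 (pow_pos (by omega) _))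

/-- The indicator function of a predicate. -/
noncomputable def ind (p : ℕ → Prop) (i : ℕ) : ℝ := if p i then 1 else 0

lemma adm_of_le_one {f : ℕ → ℝ} (h0 : ∀ i, 0 ≤ f i) (h1 : ∀ i, f i ≤ 1) : Adm f := fun i => by
  refine ⟨h0 i, (h1 i).trans ?_⟩
  exact_mod_cast base_pos (st i)

lemma adm_ind (p : ℕ → Prop) : Adm (ind p) :=
  adm_of_le_one (fun i => by unfold ind; split_ifs <;> norm_num)
    (fun i => by unfold ind; split_ifs <;> norm_num)

lemma sum_ind (p : ℕ → Prop) (n : ℕ) : ∑ i ∈ range n, ind p i = ((range n).filter p).card := by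
  simp only [ind, sum_boole]

lemma psum_ind (p : ℕ → Prop) (u : ℕ) :
    psum (ind p) u = ((range (plen (stage u))).filter fun o => p (start u + o)).card := by
  simp only [psum, ind, sum_boole]

lemma eventually_le_alph (a : ℕ) : ∀ᶠ u in atTop, a ≤ alph (stage u) := by
  filter_upwards [tendsto_stage.eventually_ge_atTop a] with u hu
  unfold alph; omega

lemma eventually_psum_occ {E : ℕ → ℕ} (hE : Follows S E) {s m r k : ℕ} (B : Fin k → ℕ)
    (hk : 0 < k) (hs : 0 < s) (hm : 0 < m) :
    ∀ᶠ u in atTop, psum (ind (Occ E s m r B)) u = count S (stage u) (start u) s m r k := by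
  filter_upwards [eventually_le_alph s, eventually_le_alph m,
    eventually_le_alph (univ.sup B + 1)] with u h1 h2 h3
  have hB : ∀ j, B j < alph (stage u) := fun j =>
    lt_of_lt_of_le (Nat.lt_succ_of_le (le_sup (mem_univ j))) h3
  rw [psum_ind, card_occ hE hk h1 hB (dvd_cell hm h2), sum_words hk hs hB]

theorem tendsto_occ_ratio {E : ℕ → ℕ} (hE : Follows S E) {s m r k : ℕ} (B₁ B₂ : Fin k → ℕ)
    (hk : 0 < k) (hs : 0 < s) (hr : r < m) :
    Tendsto (fun n => (((range n).filter (Occ E s m r B₁)).card : ℝ) /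
      ((range n).filter (Occ E s m r B₂)).card) atTop (𝓝 1) := by
  have h1 := eventually_psum_occ (r := r) hE B₁ hk hs (by omega : 0 < m)
  have h2 := eventually_psum_occ (r := r) hE B₂ hk hs (by omega : 0 < m)
  have h := tendsto_ratio (adm_ind (Occ E s m r B₁)) (adm_ind (Occ E s m r B₂)) ?_ 1 ?_
  · simpa only [sum_ind] using h
  · filter_upwards [h2, eventually_le_alph (m + s * (k - 1))] with u hu h3
    rw [hu]
    exact_mod_cast one_le_count hr h3
  · refine (Asymptotics.isLittleO_zero _ _).congr' ?_ EventuallyEq.rfl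
    filter_upwards [h1, h2] with u h3 h4
    rw [h3, h4]; ring

/-- `q_i^{-k}`. -/
noncomputable def qinv (k i : ℕ) : ℝ := ((Qs i : ℝ) ^ k)⁻¹

lemma adm_qinv (k : ℕ) : Adm (qinv k) := by
  refine adm_of_le_one (fun i => by unfold qinv; positivity) fun i => ?_
  refine inv_le_one_of_one_le₀ (one_le_pow₀ ?_)
  exact_mod_cast base_pos (st i)

lemma psum_qinv {k u : ℕ} (h : k ≤ alph (stage u)) :
    psum (qinv k) u = cell (stage u) * base (stage u) ^ (alph (stage u) - k) := by
  have h1 : ∀ o ∈ range (plen (stage u)), qinv k (start u + o) = ((base (stage u) : ℝ) ^ k)⁻¹ := by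
    intro o ho
    rw [qinv, Qs, st_start_add (mem_range.1 ho)]
  have h2 : (base (stage u) : ℝ) ≠ 0 := by exact_mod_cast (base_pos _).ne'
  rw [psum, sum_congr rfl h1, sum_const, card_range, nsmul_eq_mul, plen]
  push_cast
  rw [pow_sub₀ _ h2 h]
  ring

lemma one_le_psum_qinv (k : ℕ) : ∀ᶠ u in atTop, 1 ≤ psum (qinv k) u := by
  filter_upwards [eventually_le_alph k] with u hu
  rw [psum_qinv hu]
  exact_mod_cast Nat.mul_pos (cell_pos _) (pow_pos (base_pos _) _)

lemma exists_start_mod (m : ℕ) (hm : 0 < m) : ∃ e, ∀ᶠ u in atTop, start u % m = e := by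
  obtain ⟨u₀, h₀⟩ := eventually_atTop.1 (eventually_le_alph m)
  refine ⟨start u₀ % m, eventually_atTop.2 ⟨u₀, fun u hu => ?_⟩⟩
  induction u, hu using Nat.le_induction with
  | base => rfl
  | succ u hu ih =>
    obtain ⟨c, hc⟩ := dvd_cell hm (h₀ u hu)
    rw [start_succ, plen, hc, mul_assoc, Nat.add_mul_mod_self_left, ih]

variable (S) in
/-- The limiting relative frequency of blocks of length `k`. -/
noncomputable def rho (k : ℕ) : ℝ := if k ∈ S then 1 else 2

theorem tendsto_occ_freq {E : ℕ → ℕ} (hE : Follows S E) {m r k e : ℕ} (B : Fin k → ℕ)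
    (hk : 0 < k) (hm : 0 < m) (he : ∀ᶠ u in atTop, start u % m = e) :
    Tendsto (fun n => (((range n).filter (Occ E 1 m r B)).card : ℝ) /
      ∑ i ∈ range n, qinv k i) atTop (𝓝 (if e = r then rho S k else 0)) := by
  have h := tendsto_ratio (adm_ind (Occ E 1 m r B)) (adm_qinv k) (one_le_psum_qinv k)
    (if e = r then rho S k else 0) ?_
  · simpa only [sum_ind] using h
  refine Asymptotics.isLittleO_iff.2 fun c hc => ?_
  obtain ⟨T, hT⟩ := exists_nat_gt c⁻¹
  filter_upwards [eventually_psum_occ (r := r) hE B hk one_pos hm, he, eventually_le_alph k,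
    eventually_le_alph T] with u h1 h2 h3 h4
  rw [h1, psum_qinv h3]
  obtain ⟨h5, h6⟩ := count_bounds (S := S) (e := start u) (m := m) (r := r) hk h3
  rw [h2] at h5 h6
  have h7 : ((if e = r then mult S (stage u) k else 0 : ℕ) : ℝ)
      = (if e = r then rho S k else 0) *
        (cell (stage u) * base (stage u) ^ (alph (stage u) - k)) := by
    unfold mult rho
    split_ifs <;> push_cast <;> ring
  have h5' : ((if e = r then mult S (stage u) k else 0 : ℕ) : ℝ)
      ≤ count S (stage u) (start u) 1 m r k := Nat.cast_le.2 h5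
  have h11 : (0 : ℝ) ≤ (base (stage u) : ℝ) ^ (alph (stage u) - k) :=
    pow_nonneg (Nat.cast_nonneg _) _
  rw [← h7, Real.norm_eq_abs, abs_of_nonneg (sub_nonneg.2 h5'),
    Real.norm_of_nonneg (mul_nonneg (Nat.cast_nonneg _) h11)]
  have h8 : c⁻¹ ≤ cell (stage u) := by
    refine hT.le.trans ?_
    have h8 := two_mul_alph_le_cell (stage u)
    exact Nat.cast_le.2 (h4.trans (by omega))
  have h9 : (1 : ℝ) ≤ c * cell (stage u) := by
    rwa [inv_le_iff_one_le_mul₀' hc] at h8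
  have h10 : (count S (stage u) (start u) 1 m r k : ℝ) ≤
      ((if e = r then mult S (stage u) k else 0 : ℕ) : ℝ)
        + (base (stage u) : ℝ) ^ (alph (stage u) - k) := by
    refine (Nat.cast_le.2 h6).trans_eq ?_
    rw [Nat.cast_add, Nat.cast_pow]
  nlinarith

lemma card_special_le (u : ℕ) :
    ((range (plen (stage u))).filter fun o => dg S (start u + o) ≠ none).card
      ≤ base (stage u) ^ alph (stage u) * alph (stage u) := by
  have h : base (stage u) ^ alph (stage u) * alph (stage u)
      = (range (base (stage u) ^ alph (stage u)) ×ˢ range (alph (stage u))).card := by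
    rw [card_product, card_range, card_range]
  rw [h]
  refine card_le_card_of_injOn (fun o => (o / cell (stage u), o % cell (stage u))) ?_ ?_
  · intro o ho
    simp only [mem_coe, mem_filter, mem_range, mem_product] at ho ⊢
    refine ⟨Nat.div_lt_of_lt_mul ho.1, ?_⟩
    obtain ⟨v, hv⟩ := Option.ne_none_iff_exists'.1 ho.2
    rw [dg_start_add ho.1] at hv
    obtain ⟨x, y, hy, rfl, -⟩ := exists_of_pat hv
    have := len_le x
    have := two_mul_alph_le_cell (stage u)
    rw [mul_comm, Nat.mul_add_mod, Nat.mod_eq_of_lt (by omega)]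
    omega
  · intro a _ b _ h
    simp only [Prod.mk.injEq] at h
    rw [← Nat.div_add_mod a (cell (stage u)), h.1, h.2, Nat.div_add_mod]

lemma psum_special_le (u : ℕ) :
    psum (ind fun i => dg S i ≠ none) u * alph (stage u) ≤ plen (stage u) := by
  rw [psum_ind]
  have h1 := card_special_le (S := S) u
  have h2 := alph_sq_le_cell (stage u)
  have : ((range (plen (stage u))).filter fun o => dg S (start u + o) ≠ none).card
      * alph (stage u) ≤ plen (stage u) :=
    calc _ ≤ base (stage u) ^ alph (stage u) * alph (stage u) * alph (stage u) := by gcongr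
      _ = alph (stage u) ^ 2 * base (stage u) ^ alph (stage u) := by ring
      _ ≤ _ := by unfold plen; gcongr
  exact_mod_cast this

/-- The value of the Cantor series with digits `E`. -/
noncomputable def cval (q E : ℕ → ℕ) : ℝ := ∑' t, (E t : ℝ) / ∏ i ∈ range (t + 1), (q i : ℝ)

/-- Digits that are never maximal. -/
def IsDigits (q E : ℕ → ℕ) : Prop := ∀ n, E n + 2 ≤ q n

lemma TQ_nonneg (q : ℕ → ℕ) (n : ℕ) (x : ℝ) : 0 ≤ TQ q n x := Int.fract_nonneg _

lemma TQ_lt_one (q : ℕ → ℕ) (n : ℕ) (x : ℝ) : TQ q n x < 1 := Int.fract_lt_one _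

section

variable {q E : ℕ → ℕ} (h : IsDigits q E)

include h

lemma IsDigits.basic : IsBasic q := fun n => (Nat.le_add_left 2 (E n)).trans (h n)

lemma IsDigits.pos (n : ℕ) : (0 : ℝ) < q n := by
  have := h n
  exact_mod_cast (by omega : 0 < q n)

lemma IsDigits.shift (n : ℕ) : IsDigits (fun i => q (i + n)) (fun i => E (i + n)) :=
  fun i => h (i + n)

lemma IsDigits.sum_le (n : ℕ) :
    ∑ t ∈ range n, (E t : ℝ) / ∏ i ∈ range (t + 1), (q i : ℝ)
      ≤ 1 - 1 / ∏ i ∈ range n, (q i : ℝ) := by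
  induction n with
  | zero => simp
  | succ n ih =>
    rw [sum_range_succ]
    have hp : (0 : ℝ) < ∏ i ∈ range n, (q i : ℝ) := prod_pos fun i _ => h.pos i
    have hq := h.pos n
    have hE : (E n : ℝ) + 1 ≤ q n := by exact_mod_cast (by have := h n; omega : E n + 1 ≤ q n)
    have h1 : (E n : ℝ) / ∏ i ∈ range (n + 1), (q i : ℝ)
        ≤ 1 / ∏ i ∈ range n, (q i : ℝ) - 1 / ∏ i ∈ range (n + 1), (q i : ℝ) := by
      rw [le_sub_iff_add_le, ← add_div, prod_range_succ]
      rw [div_le_div_iff₀ (by positivity) hp]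
      nlinarith
    linarith

lemma IsDigits.nonneg (n : ℕ) : (0 : ℝ) ≤ (E n : ℝ) / ∏ i ∈ range (n + 1), (q i : ℝ) :=
  div_nonneg (Nat.cast_nonneg _) (prod_nonneg fun i _ => (h.pos i).le)

lemma IsDigits.sum_le_one (n : ℕ) :
    ∑ t ∈ range n, (E t : ℝ) / ∏ i ∈ range (t + 1), (q i : ℝ) ≤ 1 := by
  have h1 := h.sum_le n
  have hp : (0 : ℝ) < ∏ i ∈ range n, (q i : ℝ) := prod_pos fun i _ => h.pos i
  have : 0 ≤ 1 / ∏ i ∈ range n, (q i : ℝ) := by positivity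
  linarith

lemma IsDigits.summable : Summable fun t => (E t : ℝ) / ∏ i ∈ range (t + 1), (q i : ℝ) :=
  summable_of_sum_range_le h.nonneg h.sum_le_one

lemma cval_nonneg : 0 ≤ cval q E := tsum_nonneg h.nonneg

lemma cval_le_one : cval q E ≤ 1 := Real.tsum_le_of_sum_range_le h.nonneg h.sum_le_one

lemma cval_eq : cval q E = (E 0 + cval (fun i => q (i + 1)) fun i => E (i + 1)) / q 0 := by
  rw [cval, h.summable.tsum_eq_zero_add, cval, add_div, ← tsum_div_const]
  congr 1
  · simp
  · congr 1
    ext t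
    rw [prod_range_succ' _ (t + 1), div_div]

lemma cval_lt_one : cval q E < 1 := by
  rw [cval_eq h, div_lt_one (h.pos 0)]
  have h1 := cval_le_one (h.shift 1)
  have h2 : (E 0 : ℝ) + 2 ≤ q 0 := by exact_mod_cast h 0
  linarith

lemma qprod_mul_cval (n : ℕ) : ∃ c : ℕ, qprod q n * cval q E
    = c + cval (fun i => q (i + n)) fun i => E (i + n) := by
  induction n with
  | zero => exact ⟨0, by simp [qprod]⟩
  | succ n ih =>
    obtain ⟨c, hc⟩ := ih
    refine ⟨q n * c + E n, ?_⟩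
    have h1 := cval_eq (h.shift n)
    have h2 := (h.pos n).ne'
    simp only [zero_add] at h1
    rw [eq_div_iff h2] at h1
    have h3 : qprod q (n + 1) = qprod q n * q n := prod_range_succ _ _
    rw [h3, mul_right_comm, hc, add_mul, h1]
    push_cast
    have h4 : ∀ i, i + 1 + n = i + (n + 1) := fun i => by ring
    simp only [h4]
    ring

lemma TQ_cval (n : ℕ) : TQ q n (cval q E) = cval (fun i => q (i + n)) fun i => E (i + n) := by
  obtain ⟨c, hc⟩ := qprod_mul_cval h n
  rw [TQ, hc, Int.fract_natCast_add, Int.fract_eq_self]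
  exact ⟨cval_nonneg (h.shift n), cval_lt_one (h.shift n)⟩

lemma mul_TQ_cval (n : ℕ) :
    (q n : ℝ) * TQ q n (cval q E) = E n + TQ q (n + 1) (cval q E) := by
  rw [TQ_cval h, TQ_cval h, cval_eq (h.shift n)]
  have h2 := (h.pos n).ne'
  have h4 : ∀ i, i + 1 + n = i + (n + 1) := fun i => by ring
  simp only [zero_add, h4]
  field_simp

lemma qdigit_cval (n : ℕ) : qdigit q (cval q E) n = E n := by
  rw [qdigit, mul_TQ_cval h, add_comm,
    Nat.floor_add_natCast (TQ_nonneg _ _ _), Nat.floor_eq_zero.2 (TQ_lt_one _ _ _), zero_add]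

lemma Ups_cval (m r : ℕ) : Ups q m r (cval q E) = cval (lamQ q m r) fun t => E (m * t + r) := by
  simp only [Ups, qdigit_cval h]
  rfl

lemma IsDigits.lam (m r : ℕ) : IsDigits (lamQ q m r) fun t => E (m * t + r) :=
  fun t => h (m * t + r)

lemma qdigit_Ups (m r t : ℕ) :
    qdigit (lamQ q m r) (Ups q m r (cval q E)) t = E (m * t + r) := by
  rw [Ups_cval h, qdigit_cval (h.lam m r)]

end

lemma TQ_succ (w : ℕ → ℕ) (n : ℕ) (z : ℝ) :
    (w n : ℝ) * TQ w n z = qdigit w z n + TQ w (n + 1) z := by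
  have h3 : qprod w (n + 1) = w n * qprod w n := by
    rw [qprod, prod_range_succ, mul_comm]; rfl
  have h1 : (0 : ℝ) ≤ (w n : ℝ) * TQ w n z := mul_nonneg (Nat.cast_nonneg _) (Int.fract_nonneg _)
  have h2 : TQ w (n + 1) z = Int.fract ((w n : ℝ) * TQ w n z) := by
    have : (w n : ℝ) * TQ w n z
        = w n * (qprod w n * z) - ((w n * ⌊qprod w n * z⌋ : ℤ) : ℝ) := by
      rw [TQ, Int.fract]; push_cast; ring
    rw [this, Int.fract_sub_intCast, TQ, h3, mul_assoc]
  rw [h2, qdigit, Int.fract, ← natCast_floor_eq_intCast_floor h1]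
  ring

lemma qdigit_lt {w : ℕ → ℕ} {n : ℕ} (h : 0 < w n) (z : ℝ) : qdigit w z n < w n := by
  rw [qdigit, Nat.floor_lt (mul_nonneg (Nat.cast_nonneg _) (TQ_nonneg _ _ _))]
  have : (0 : ℝ) < w n := by exact_mod_cast h
  exact mul_lt_of_lt_one_right this (Int.fract_lt_one _)

lemma TQ_zero (q : ℕ → ℕ) {x : ℝ} (hx : x ∈ Set.Ico (0 : ℝ) 1) : TQ q 0 x = x := by
  rw [TQ, qprod, range_zero, prod_empty, one_mul, Int.fract_eq_self]
  exact hx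

lemma TQ_sub_of_digits_eq (w : ℕ → ℕ) {z z' : ℝ} (hz : z ∈ Set.Ico (0 : ℝ) 1)
    (hz' : z' ∈ Set.Ico (0 : ℝ) 1) {n : ℕ} (h : ∀ i < n, qdigit w z i = qdigit w z' i) :
    TQ w n z - TQ w n z' = qprod w n * (z - z') := by
  induction n with
  | zero => rw [TQ_zero w hz, TQ_zero w hz']; simp [qprod]
  | succ n ih =>
    have h1 := TQ_succ w n z
    have h2 := TQ_succ w n z'
    have h3 := ih fun i hi => h i (by omega)
    have h4 : qprod w (n + 1) = qprod w n * w n := prod_range_succ _ _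
    rw [h n (by omega)] at h1
    rw [h4, mul_right_comm, ← h3, sub_mul, mul_comm _ (w n : ℝ), mul_comm _ (w n : ℝ), h1, h2]
    ring

lemma abs_sub_le_of_digits_eq {w : ℕ → ℕ} (hw : ∀ i, 0 < w i) {z z' : ℝ}
    (hz : z ∈ Set.Ico (0 : ℝ) 1) (hz' : z' ∈ Set.Ico (0 : ℝ) 1) {n : ℕ}
    (h : ∀ i < n, qdigit w z i = qdigit w z' i) : |z - z'| ≤ 1 / qprod w n := by
  have hp : 0 < qprod w n := prod_pos fun i _ => by exact_mod_cast hw i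
  have h1 := TQ_sub_of_digits_eq w hz hz' h
  have h2 : qprod w n * |z - z'| = |qprod w n * (z - z')| := by rw [abs_mul, abs_of_pos hp]
  rw [le_div_iff₀ hp, mul_comm, h2, ← h1]
  have h3 := TQ_nonneg w n z
  have h4 := TQ_lt_one w n z
  have h5 := TQ_nonneg w n z'
  have h6 := TQ_lt_one w n z'
  exact abs_le.2 ⟨by linarith, by linarith⟩

lemma le_abs_cval_sub {q E E' : ℕ → ℕ} (hE : IsDigits q E) (hE' : IsDigits q E') {n : ℕ}
    (h : ∀ i < n, E i = E' i) (hn : E n ≠ E' n) :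
    1 / qprod q (n + 2) ≤ |cval q E - cval q E'| := by
  wlog hlt : E n < E' n generalizing E E'
  · rw [abs_sub_comm]
    exact this hE' hE (fun i hi => (h i hi).symm) hn.symm (by omega)
  have hq := hE.pos n
  have hq1 := hE.pos (n + 1)
  have hp : 0 < qprod q n := prod_pos fun i _ => hE.pos i
  have h1 := TQ_sub_of_digits_eq q ⟨cval_nonneg hE, cval_lt_one hE⟩
    ⟨cval_nonneg hE', cval_lt_one hE'⟩ (n := n)
    (fun i hi => by rw [qdigit_cval hE, qdigit_cval hE', h i hi])
  have h2 := mul_TQ_cval hE n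
  have h3 := mul_TQ_cval hE' n
  have h4 := mul_TQ_cval hE (n + 1)
  have h5 := TQ_lt_one q (n + 1 + 1) (cval q E)
  have h6 := TQ_nonneg q (n + 1) (cval q E')
  have h7 : (E (n + 1) : ℝ) + 2 ≤ q (n + 1) := by exact_mod_cast hE (n + 1)
  have h8 : (E n : ℝ) + 1 ≤ E' n := by exact_mod_cast hlt
  have h9 : qprod q (n + 2) = qprod q n * q n * q (n + 1) := by
    rw [qprod, prod_range_succ, prod_range_succ]; rfl
  have h10 : 1 ≤ (cval q E' - cval q E) * qprod q (n + 2) := by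
    have e : (cval q E' - cval q E) * qprod q (n + 2)
        = (q n * TQ q n (cval q E') - q n * TQ q n (cval q E)) * q (n + 1) := by
      rw [h9]; linear_combination (q n : ℝ) * q (n + 1) * h1
    rw [e, h2, h3]
    nlinarith
  have hp2 : 0 < qprod q (n + 2) := prod_pos fun i _ => hE.pos i
  rw [div_le_iff₀ hp2, abs_sub_comm]
  exact h10.trans (mul_le_mul_of_nonneg_right (le_abs_self _) hp2.le)

lemma tendsto_div_of_abs_sub_le {a b : ℕ → ℝ} {C : ℝ} (hb : Tendsto b atTop atTop)
    (h : ∀ n, |a n - b n| ≤ C) : Tendsto (fun n => a n / b n) atTop (𝓝 1) := by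
  have h1 : Tendsto (fun n => (a n - b n) / b n) atTop (𝓝 0) := by
    refine squeeze_zero_norm' ?_ (hb.const_div_atTop C)
    filter_upwards [hb.eventually_gt_atTop 0] with n hn
    rw [norm_div, Real.norm_eq_abs, Real.norm_of_nonneg hn.le]
    exact div_le_div_of_nonneg_right (h n) hn.le
  have h2 := h1.add_const 1
  rw [zero_add] at h2
  refine h2.congr' ?_
  filter_upwards [hb.eventually_gt_atTop 0] with n hn
  field_simp
  ring

section

variable {h : ℕ → ℝ} (h0 : ∀ i, 0 ≤ h i) (h1 : ∀ i, h i ≤ 1)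

include h0 h1

lemma abs_sum_range_add_sub_le (a b : ℕ) :
    |∑ i ∈ range (a + b), h i - ∑ i ∈ range a, h i| ≤ b := by
  rw [sum_range_add, add_sub_cancel_left, abs_of_nonneg (sum_nonneg fun i _ => h0 _)]
  refine (sum_le_sum fun i _ => h1 _).trans ?_
  simp

lemma abs_sum_sub_sum_le {a b c : ℕ} (hab : a ≤ b + c) (hba : b ≤ a + c) :
    |∑ i ∈ range a, h i - ∑ i ∈ range b, h i| ≤ c := by
  rcases le_total b a with hle | hle
  · obtain ⟨d, rfl⟩ := Nat.exists_eq_add_of_le hle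
    exact (abs_sum_range_add_sub_le h0 h1 b d).trans (Nat.cast_le.2 (by omega))
  · obtain ⟨d, rfl⟩ := Nat.exists_eq_add_of_le hle
    rw [abs_sub_comm]
    exact (abs_sum_range_add_sub_le h0 h1 a d).trans (Nat.cast_le.2 (by omega))

lemma abs_mul_sum_sub_sum_le (ha : Antitone h) {m r : ℕ} (hr : r < m) (N : ℕ) :
    |m * ∑ j ∈ range N, h (m * j + r) - ∑ i ∈ range (m * N), h i| ≤ m := by
  have key : ∀ N : ℕ, |m * ∑ j ∈ range N, h (m * j + r) - ∑ i ∈ range (m * N), h i|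
      ≤ m * (h 0 - h (m * N)) := by
    intro N
    induction N with
    | zero => simp
    | succ N ih =>
      have e : m * ∑ j ∈ range (N + 1), h (m * j + r) - ∑ i ∈ range (m * (N + 1)), h i
          = (m * ∑ j ∈ range N, h (m * j + r) - ∑ i ∈ range (m * N), h i)
            + ∑ i ∈ range m, (h (m * N + r) - h (m * N + i)) := by
        rw [sum_range_succ, Nat.mul_succ, sum_range_add, sum_sub_distrib, sum_const, card_range,
          nsmul_eq_mul]
        ring
      have h2 : |∑ i ∈ range m, (h (m * N + r) - h (m * N + i))|
          ≤ m * (h (m * N) - h (m * (N + 1))) := by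
        refine (abs_sum_le_sum_abs _ _).trans ((sum_le_sum (g := fun _ =>
          h (m * N) - h (m * (N + 1))) fun i hi => ?_).trans_eq (by
          rw [sum_const, card_range, nsmul_eq_mul]))
        rw [mem_range] at hi
        have a1 := ha (show m * N ≤ m * N + r by omega)
        have a2 := ha (show m * N ≤ m * N + i by omega)
        have a3 := ha (show m * N + r ≤ m * (N + 1) by rw [Nat.mul_succ]; omega)
        have a4 := ha (show m * N + i ≤ m * (N + 1) by rw [Nat.mul_succ]; omega)
        exact abs_le.2 ⟨by linarith, by linarith⟩
      rw [e]
      refine (abs_add_le _ _).trans ((add_le_add ih h2).trans_eq ?_)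
      ring
  refine (key N).trans ?_
  have := h0 (m * N)
  have := h1 0
  exact mul_le_of_le_one_right (Nat.cast_nonneg _) (by linarith)

end

lemma qinv_nonneg (k i : ℕ) : 0 ≤ qinv k i := (adm_qinv k i).1

lemma qinv_le_one (k i : ℕ) : qinv k i ≤ 1 :=
  inv_le_one_of_one_le₀ (one_le_pow₀ (Nat.one_le_cast.2 (base_pos (st i))))

/-- `1 / (q_j q_{j+1} ⋯ q_{j+k-1})`. -/
noncomputable def prodInv (k j : ℕ) : ℝ := (∏ i ∈ range k, (Qs (j + i) : ℝ))⁻¹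

lemma Qs_pos (n : ℕ) : (0 : ℝ) < Qs n := Nat.cast_pos.2 (base_pos _)

lemma prodInv_le (k j : ℕ) : prodInv k j ≤ qinv k j := by
  refine inv_anti₀ (pow_pos (Qs_pos j) k) ?_
  calc (Qs j : ℝ) ^ k = ∏ i ∈ range k, (Qs j : ℝ) := by simp
    _ ≤ _ := prod_le_prod (fun i _ => (Qs_pos j).le)
      fun i _ => Nat.cast_le.2 (Qs_mono (Nat.le_add_right _ _))

lemma le_prodInv (k j : ℕ) : qinv k (j + k) ≤ prodInv k j := by
  refine inv_anti₀ (prod_pos fun i _ => Qs_pos _) ?_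
  have h : ∏ i ∈ range k, (Qs (j + i) : ℝ) ≤ ∏ i ∈ range k, (Qs (j + k) : ℝ) :=
    prod_le_prod (fun i _ => (Qs_pos _).le)
      fun i hi => Nat.cast_le.2 (Qs_mono (by rw [mem_range] at hi; omega))
  rwa [prod_const, card_range] at h

lemma prodInv_nonneg (k j : ℕ) : 0 ≤ prodInv k j := (qinv_nonneg k _).trans (le_prodInv k j)

lemma prodInv_le_one (k j : ℕ) : prodInv k j ≤ 1 := (prodInv_le k j).trans (qinv_le_one k j)

lemma prodInv_anti (k : ℕ) : Antitone (prodInv k) := fun _ _ h => by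
  refine inv_anti₀ (prod_pos fun i _ => Qs_pos _) (prod_le_prod (fun i _ => (Qs_pos _).le)
    fun i _ => Nat.cast_le.2 (Qs_mono (by omega)))

lemma qinv_anti (k : ℕ) : Antitone (qinv k) := fun a _ h =>
  inv_anti₀ (pow_pos (Qs_pos a) k)
    (pow_le_pow_left₀ (Qs_pos a).le (Nat.cast_le.2 (Qs_mono h)) k)

lemma abs_Qsum_sub_le (k n : ℕ) : |Qsum Qs k n - ∑ i ∈ range n, qinv k i| ≤ k := by
  have h1 : Qsum Qs k n ≤ ∑ i ∈ range n, qinv k i := sum_le_sum fun j _ => prodInv_le k j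
  have h2 : ∑ j ∈ range n, qinv k (k + j) ≤ Qsum Qs k n := sum_le_sum fun j _ => by
    rw [add_comm]; exact le_prodInv k j
  have h3 : ∑ i ∈ range (k + n), qinv k i
      = ∑ i ∈ range k, qinv k i + ∑ j ∈ range n, qinv k (k + j) := sum_range_add _ _ _
  have h4 : ∑ i ∈ range k, qinv k i ≤ k :=
    (sum_le_sum fun i _ => qinv_le_one k i).trans (by simp)
  have h5 : ∑ i ∈ range n, qinv k i ≤ ∑ i ∈ range (k + n), qinv k i :=
    sum_le_sum_of_subset_of_nonneg (range_subset_range.2 (by omega))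
      fun i _ _ => qinv_nonneg k i
  exact abs_le.2 ⟨by linarith, by linarith [(Nat.cast_nonneg k : (0 : ℝ) ≤ k)]⟩

lemma tendsto_sum_qinv (k : ℕ) : Tendsto (fun n => ∑ i ∈ range n, qinv k i) atTop atTop :=
  tendsto_sum_atTop (adm_qinv k) (one_le_psum_qinv k)

lemma tendsto_Qsum_div (k : ℕ) :
    Tendsto (fun n => Qsum Qs k n / ∑ i ∈ range n, qinv k i) atTop (𝓝 1) :=
  tendsto_div_of_abs_sub_le (tendsto_sum_qinv k) (abs_Qsum_sub_le k)

lemma fullyDivergent_Qs : FullyDivergent Qs := fun k _ => by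
  refine tendsto_atTop_mono (fun n => ?_)
    (tendsto_atTop_add_const_right _ (-(k : ℝ)) (tendsto_sum_qinv k))
  have := (abs_le.1 (abs_Qsum_sub_le k n)).1
  linarith

lemma tendsto_apQsum_div {m r : ℕ} (hr : r < m) :
    Tendsto (fun n => m * apQsum Qs m r n / ∑ i ∈ range n, qinv m i) atTop (𝓝 1) := by
  refine tendsto_div_of_abs_sub_le (C := m + 2 * m + m) (tendsto_sum_qinv m) fun n => ?_
  set N := (n - r) / m + 1 with hN
  have h1 := abs_mul_sum_sub_sum_le (prodInv_nonneg m) (prodInv_le_one m) (prodInv_anti m) hr N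
  have hmN : m * N ≤ n + 2 * m ∧ n ≤ m * N + 2 * m := by
    have h3 := Nat.div_add_mod (n - r) m
    have h4 := Nat.mod_lt (n - r) (by omega : 0 < m)
    rw [hN, Nat.mul_succ]
    omega
  have h2 := abs_sum_sub_sum_le (prodInv_nonneg m) (prodInv_le_one m) (c := 2 * m) hmN.1 hmN.2
  have h3 := abs_Qsum_sub_le m n
  have e : m * apQsum Qs m r n - ∑ i ∈ range n, qinv m i
      = (m * ∑ j ∈ range N, prodInv m (m * j + r) - ∑ i ∈ range (m * N), prodInv m i)
        + (∑ i ∈ range (m * N), prodInv m i - ∑ i ∈ range n, prodInv m i)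
        + (Qsum Qs m n - ∑ i ∈ range n, qinv m i) := by
    change _ = _ + (_ - Qsum Qs m n) + _
    change m * ∑ j ∈ range N, prodInv m (m * j + r) - _ = _
    ring
  rw [e]
  refine (abs_add_le _ _).trans (add_le_add ((abs_add_le _ _).trans (add_le_add h1 ?_)) h3)
  push_cast at h2
  exact h2

lemma tendsto_Qsum_lamQ_div {m r : ℕ} (hr : r < m) :
    Tendsto (fun n => m * Qsum (lamQ Qs m r) 1 n / ∑ i ∈ range (m * n), qinv 1 i)
      atTop (𝓝 1) := by
  refine tendsto_div_of_abs_sub_le (C := m)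
    ((tendsto_sum_qinv 1).comp (tendsto_id.const_mul_atTop' (by omega))) fun n => ?_
  have := abs_mul_sum_sub_sum_le (qinv_nonneg 1) (qinv_le_one 1) (qinv_anti 1) hr n
  simpa [Qsum, lamQ, qinv] using this

section claims

variable {E : ℕ → ℕ} (hE : Follows S E) (hd : IsDigits Qs E)

include hd

lemma apCount_cval {m r : ℕ} (B : Fin m → ℕ) (n : ℕ) :
    apCount Qs (cval Qs E) m r B n = ((range n).filter (Occ E 1 m r B)).card := by
  unfold apCount
  refine congrArg card (filter_congr fun i _ => ?_)
  simp only [qdigit_cval hd, Occ, one_mul]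

lemma blockCount_cval {k : ℕ} (B : Fin k → ℕ) (n : ℕ) :
    blockCount Qs (cval Qs E) B n = ((range n).filter (Occ E 1 1 0 B)).card := by
  unfold blockCount
  refine congrArg card (filter_congr fun i _ => ?_)
  simp only [qdigit_cval hd, Occ, one_mul, Nat.mod_one, true_and]

lemma blockCount_Ups {k m r : ℕ} (hr : r < m) (B : Fin k → ℕ) (n : ℕ) :
    blockCount (lamQ Qs m r) (Ups Qs m r (cval Qs E)) B n
      = ((range (m * n)).filter (Occ E m m r B)).card := by
  have hm : 0 < m := by omega
  unfold blockCount
  rw [← card_image_of_injective (f := fun t => m * t + r) _ fun a b hab => by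
    exact Nat.eq_of_mul_eq_mul_left hm (Nat.add_right_cancel hab)]
  refine congrArg card (Finset.ext fun i => ?_)
  simp only [mem_image, mem_filter, mem_range, qdigit_Ups hd, Occ]
  constructor
  · rintro ⟨t, ⟨ht, hB⟩, rfl⟩
    refine ⟨?_, ?_, fun j => ?_⟩
    · calc m * t + r < m * (t + 1) := by rw [Nat.mul_succ]; omega
        _ ≤ m * n := Nat.mul_le_mul_left _ ht
    · rw [Nat.mul_add_mod, Nat.mod_eq_of_lt hr]
    · rw [← hB j]; congr 1; ring
  · rintro ⟨hi, hmod, hB⟩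
    have h1 := Nat.div_add_mod i m
    refine ⟨i / m, ⟨Nat.div_lt_of_lt_mul hi, fun j => ?_⟩, by omega⟩
    rw [← hB j, ← hmod]; congr 1
    rw [mul_add]; omega

include hE

lemma memRNI_cval : MemRNI Qs (cval Qs E) := fun m hm r hr B₁ B₂ => by
  simp only [apCount_cval hd]
  exact tendsto_occ_ratio hE B₁ B₂ hm one_pos hr

lemma memRNII_cval : MemRNII Qs (cval Qs E) := fun k hk m hm r hr B₁ B₂ => by
  simp only [blockCount_Ups hd hr]
  exact (tendsto_occ_ratio hE B₁ B₂ hk hm hr).comp (tendsto_id.const_mul_atTop' (by omega))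

lemma tendsto_blockCount_cval {k : ℕ} (hk : 0 < k) (B : Fin k → ℕ) :
    Tendsto (fun n => (blockCount Qs (cval Qs E) B n : ℝ) / Qsum Qs k n) atTop
      (𝓝 (rho S k)) := by
  have h1 := tendsto_occ_freq hE B hk one_pos (r := 0) (e := 0)
    (Eventually.of_forall fun u => Nat.mod_one _)
  have h2 := h1.div (tendsto_Qsum_div k) one_ne_zero
  rw [if_pos rfl, div_one] at h2
  refine h2.congr' ?_
  filter_upwards [(tendsto_sum_qinv k).eventually_gt_atTop 0] with n hn
  rw [blockCount_cval hd, Pi.div_apply, div_div_div_cancel_right₀ hn.ne']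

lemma qNormalOfOrder_cval {k : ℕ} (hk : 0 < k) (hkS : k ∈ S) :
    QNormalOfOrder Qs k (cval Qs E) := fun B => by
  have := tendsto_blockCount_cval hE hd hk B
  rwa [rho, if_pos hkS] at this

lemma not_qNormalOfOrder_cval {k : ℕ} (hk : 0 < k) (hkS : k ∉ S) :
    ¬ QNormalOfOrder Qs k (cval Qs E) := fun h => by
  have h1 := tendsto_blockCount_cval hE hd hk fun _ => 0
  rw [rho, if_neg hkS] at h1
  have := tendsto_nhds_unique h1 (h _)
  norm_num at this

lemma apAbnormalI_cval : APAbnormalI Qs (cval Qs E) := fun m hm r hr h => by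
  obtain ⟨e, he⟩ := exists_start_mod m (by omega)
  have h1 := tendsto_occ_freq hE (fun _ : Fin m => 0) (r := r) (by omega) (by omega) he
  have h2 := (h1.div (tendsto_apQsum_div hr) one_ne_zero).const_mul (m : ℝ)
  have hm' : (m : ℝ) ≠ 0 := by exact_mod_cast (by omega : m ≠ 0)
  have h3 : Tendsto (fun n => (apCount Qs (cval Qs E) m r (fun _ : Fin m => 0) n : ℝ)
      / apQsum Qs m r n) atTop (𝓝 (m * ((if e = r then rho S m else 0) / 1))) := by
    refine h2.congr' ?_
    filter_upwards [(tendsto_sum_qinv m).eventually_gt_atTop 0] with n hn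
    rw [apCount_cval hd, Pi.div_apply, div_div_div_cancel_right₀ hn.ne', ← mul_div_assoc,
      mul_div_mul_left _ _ hm']
  have h4 := tendsto_nhds_unique h3 (h _)
  have h5 : (2 : ℝ) ≤ m := by exact_mod_cast hm
  unfold rho at h4
  split_ifs at h4 <;> linarith

lemma not_apNormalII_cval : ¬ APNormalII Qs (cval Qs E) := fun h => by
  obtain ⟨e, he⟩ := exists_start_mod 2 (by omega)
  obtain ⟨r, hr, her⟩ : ∃ r, r < 2 ∧ e ≠ r := by
    rcases eq_or_ne e 0 with h0 | h0
    · exact ⟨1, by omega, by omega⟩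
    · exact ⟨0, by omega, h0⟩
  have h1 := tendsto_occ_freq hE (fun _ : Fin 1 => 0) (r := r) (by omega) (by omega) he
  rw [if_neg her] at h1
  have h2 := ((h1.comp (tendsto_id.const_mul_atTop' (by omega : 0 < 2))).div
    (tendsto_Qsum_lamQ_div hr) one_ne_zero).const_mul (2 : ℝ)
  have h3 := h 1 le_rfl 2 one_le_two r hr fun _ => 0
  have h4 := tendsto_nhds_unique_of_eventuallyEq h2 h3 ?_
  · norm_num at h4
  filter_upwards [((tendsto_sum_qinv 1).comp (tendsto_id.const_mul_atTop'
    (by omega : 0 < 2))).eventually_gt_atTop 0] with n hn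
  simp only [Function.comp, id] at hn
  have h5 : (Occ E 1 2 r fun _ : Fin 1 => 0) = Occ E 2 2 r fun _ : Fin 1 => 0 := by
    ext i; simp [Occ]
  rw [blockCount_Ups hd hr, Pi.div_apply, ← h5]
  simp only [Function.comp, id]
  rw [div_div_div_cancel_right₀ hn.ne', ← mul_div_assoc]
  push_cast
  rw [mul_div_mul_left _ _ two_ne_zero]

end claims

lemma lt_alph_of_dg {n v : ℕ} (h : dg S n = some v) : v < alph (st n) := by
  obtain ⟨x, y, -, -, rfl⟩ := exists_of_pat h
  exact letter_lt x y

variable (S) in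
/-- Number of admissible digits at position `n`. -/
noncomputable def width (n : ℕ) : ℕ := if dg S n = none then wid (st n) else 1

lemma width_pos (n : ℕ) : 0 < width S n := by
  unfold width
  split_ifs
  exacts [wid_pos _, one_pos]

/-- The least admissible digit at a free position. -/
noncomputable def freeLo (xs : ℕ → ℝ) (n : ℕ) : ℕ :=
  wid (st n) + if ⌈xs n * Qs n⌉₊ + 2 * wid (st n) + 1 ≤ Qs n then ⌈xs n * Qs n⌉₊ else 0

variable (S) in
/-- The digits of the point with parameter `z`. -/
noncomputable def digit (xs : ℕ → ℝ) (z : ℝ) (n : ℕ) : ℕ :=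
  (dg S n).getD (freeLo xs n) + qdigit (width S) z n

lemma wid_st_le_Qs (n : ℕ) : 32 * wid (st n) ≤ Qs n := wid_le_base _

lemma qdigit_width_lt (z : ℝ) {n : ℕ} (h : dg S n = none) :
    qdigit (width S) z n < wid (st n) := by
  have := qdigit_lt (width_pos (S := S) n) z
  rwa [width, if_pos h] at this

lemma digit_eq_of_dg (xs : ℕ → ℝ) (z : ℝ) {n v : ℕ} (h : dg S n = some v) :
    digit S xs z n = v := by
  have := qdigit_lt (width_pos (S := S) n) z
  rw [width, if_neg (by simp [h])] at this
  simp only [digit, h, Option.getD_some]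
  omega

lemma digit_eq_of_none (xs : ℕ → ℝ) (z : ℝ) {n : ℕ} (h : dg S n = none) :
    digit S xs z n = freeLo xs n + qdigit (width S) z n := by
  simp only [digit, h, Option.getD_none]

lemma follows_digit (xs : ℕ → ℝ) (z : ℝ) : Follows S (digit S xs z) := fun n =>
  ⟨fun _ h => digit_eq_of_dg xs z h, fun h => by
    rw [digit_eq_of_none xs z h, freeLo]; omega⟩

lemma isDigits_digit (xs : ℕ → ℝ) (z : ℝ) : IsDigits Qs (digit S xs z) := fun n => by
  have h1 := wid_st_le_Qs n
  have h2 := wid_pos (st n)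
  cases h : dg S n with
  | some v =>
    rw [digit_eq_of_dg xs z h]
    have h3 := lt_alph_of_dg h
    have h4 := alph_le_base (st n)
    unfold Qs; omega
  | none =>
    rw [digit_eq_of_none xs z h, freeLo]
    have := qdigit_width_lt z h
    split_ifs <;> omega

variable (S) in
/-- The point with parameter `z`. -/
noncomputable def point (xs : ℕ → ℝ) (z : ℝ) : ℝ := cval Qs (digit S xs z)

lemma fract_lt_of_free {xs : ℕ → ℝ} {n : ℕ} (hx : xs n ∈ Set.Ico (0 : ℝ) 1) (z : ℝ)
    (h : dg S n = none) {ξ : ℝ} (hξ : ξ < 1) (hn : 6 < ξ * expo (st n)) :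
    Int.fract (TQ Qs n (point S xs z) - xs n) < ξ := by
  have hq := Qs_pos n
  have hT := mul_TQ_cval (isDigits_digit (S := S) xs z) n
  have hT0 := TQ_nonneg Qs (n + 1) (cval Qs (digit S xs z))
  have hT1 := TQ_lt_one Qs (n + 1) (cval Qs (digit S xs z))
  rw [digit_eq_of_none xs z h] at hT
  have hd : (qdigit (width S) z n : ℝ) + 1 ≤ wid (st n) := by
    exact_mod_cast qdigit_width_lt z h
  have hd0 : (0 : ℝ) ≤ qdigit (width S) z n := Nat.cast_nonneg _
  have hW : (1 : ℝ) ≤ wid (st n) := Nat.one_le_cast.2 (wid_pos _)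
  have hqW : 6 * (wid (st n) : ℝ) < ξ * Qs n := by
    have e : (Qs n : ℝ) = expo (st n) * wid (st n) := Nat.cast_mul _ _
    rw [e, ← mul_assoc]
    exact mul_lt_mul_of_pos_right hn (by linarith)
  have hc0 := Nat.le_ceil (xs n * Qs n)
  have hc1 := Nat.ceil_lt_add_one (mul_nonneg hx.1 hq.le)
  change Int.fract (TQ Qs n (cval Qs (digit S xs z)) - xs n) < ξ
  set T := TQ Qs n (cval Qs (digit S xs z))
  have key : ∀ s : ℝ, 0 ≤ Qs n * s → (Qs n * s ≤ 6 * wid (st n)) → Int.fract s < ξ := by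
    intro s h0 h1
    have h2 : 0 ≤ s := nonneg_of_mul_nonneg_right h0 hq
    have h3 : s < ξ := by
      have : Qs n * s < Qs n * ξ := by linarith
      exact lt_of_mul_lt_mul_left this hq.le
    rwa [Int.fract_eq_self.2 ⟨h2, h3.trans hξ⟩]
  unfold freeLo at hT
  split_ifs at hT with hc
  · push_cast at hT
    apply key <;> linarith
  · have h4 : (Qs n : ℝ) < ⌈xs n * Qs n⌉₊ + 2 * wid (st n) + 1 := by
      have : Qs n < ⌈xs n * Qs n⌉₊ + 2 * wid (st n) + 1 := not_le.1 hc
      exact_mod_cast this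
    push_cast at hT
    have h5 : xs n * Qs n < Qs n := mul_lt_of_lt_one_left hq hx.2
    rw [← Int.fract_add_one]
    apply key <;> linarith

lemma adm_one : Adm fun _ => 1 := adm_of_le_one (fun _ => zero_le_one) fun _ => le_rfl

lemma psum_one (u : ℕ) : psum (fun _ => 1) u = plen (stage u) := by simp [psum]

lemma eventually_one_le_mul_alph {c : ℝ} (hc : 0 < c) :
    ∀ᶠ u in atTop, 1 ≤ c * alph (stage u) := by
  obtain ⟨T, hT⟩ := exists_nat_gt c⁻¹
  filter_upwards [eventually_le_alph T] with u hu
  rw [← inv_le_iff_one_le_mul₀' hc]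
  exact hT.le.trans (Nat.cast_le.2 hu)

lemma psum_special_nonneg (u : ℕ) : 0 ≤ psum (ind fun i => dg S i ≠ none) u :=
  sum_nonneg fun _ _ => (adm_ind _ _).1

lemma eventually_psum_special_le {c : ℝ} (hc : 0 < c) :
    ∀ᶠ u in atTop, psum (ind fun i => dg S i ≠ none) u ≤ c * plen (stage u) := by
  filter_upwards [eventually_one_le_mul_alph hc] with u hu
  have h1 := psum_special_le (S := S) u
  have h2 := psum_special_nonneg (S := S) u
  nlinarith

lemma tendsto_special :
    Tendsto (fun n => (((range n).filter fun i => dg S i ≠ none).card : ℝ) / n)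
      atTop (𝓝 0) := by
  have h := tendsto_ratio (adm_ind fun i => dg S i ≠ none) adm_one
    (Eventually.of_forall fun u => by
      rw [psum_one]; exact Nat.one_le_cast.2 (plen_pos _)) 0 ?_
  · simp only [sum_ind, sum_const, card_range, nsmul_eq_mul, mul_one] at h
    convert h using 5
    exact Finset.ext fun i => by simp only [mem_filter]
  refine Asymptotics.isLittleO_iff.2 fun c hc => ?_
  filter_upwards [eventually_psum_special_le (S := S) hc] with u hu
  rw [psum_one, zero_mul, sub_zero, Real.norm_of_nonneg (psum_special_nonneg u),
    Real.norm_natCast]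
  exact hu

lemma memD_point {xs : ℕ → ℝ} (hx : ∀ n, xs n ∈ Set.Ico (0 : ℝ) 1) (z : ℝ) :
    MemD Qs xs (point S xs z) := fun ξ hξ0 hξ1 => by
  obtain ⟨T, hT⟩ := exists_nat_gt (6 / ξ)
  have hev : ∀ᶠ n in atTop, 6 < ξ * expo (st n) := by
    filter_upwards [tendsto_st.eventually_ge_atTop T] with n hn
    have h1 := alph_le_expo (st n)
    have h2 : T ≤ expo (st n) := by unfold alph at h1; omega
    rw [← div_lt_iff₀' hξ0]
    exact hT.trans_le (Nat.cast_le.2 h2)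
  obtain ⟨n₀, hn₀⟩ := eventually_atTop.1 hev
  have hlow : ∀ N : ℕ, N ≤
      ((range N).filter fun n => Int.fract (TQ Qs n (point S xs z) - xs n) < ξ).card
      + (((range N).filter fun n => dg S n ≠ none).card + n₀) := by
    intro N
    have hsub : range N ⊆
        ((range N).filter fun n => Int.fract (TQ Qs n (point S xs z) - xs n) < ξ)
        ∪ (((range N).filter fun n => dg S n ≠ none) ∪ range n₀) := by
      intro n hn
      simp only [mem_union, mem_filter, hn, true_and, mem_range]
      by_contra! hcon
      exact absurd (fract_lt_of_free (hx n) z hcon.2.1 hξ1 (hn₀ n hcon.2.2))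
        (not_lt.2 hcon.1)
    have := card_le_card hsub
    rw [card_range] at this
    refine this.trans ((card_union_le _ _).trans (Nat.add_le_add_left ?_ _))
    exact (card_union_le _ _).trans_eq (by rw [card_range])
  have h1 : Tendsto (fun N : ℕ => 1 - ((((range N).filter fun i => dg S i ≠ none).card : ℝ) / N
      + n₀ / N)) atTop (𝓝 (1 - (0 + 0))) :=
    (tendsto_special.add (tendsto_const_div_atTop_nhds_zero_nat _)).const_sub 1
  rw [add_zero, sub_zero] at h1
  refine tendsto_of_tendsto_of_tendsto_of_le_of_le' h1 tendsto_const_nhds ?_ ?_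
  · filter_upwards [eventually_gt_atTop 0] with N hN
    have hN' : (0 : ℝ) < N := Nat.cast_pos.2 hN
    have h2 : (N : ℝ) ≤
      ((range N).filter fun n => Int.fract (TQ Qs n (point S xs z) - xs n) < ξ).card
      + (((range N).filter fun n => dg S n ≠ none).card + n₀) := by exact_mod_cast hlow N
    rw [sub_le_iff_le_add, ← add_div, ← add_div, le_div_iff₀ hN', one_mul]
    exact h2
  · filter_upwards [eventually_gt_atTop 0] with N hN
    rw [div_le_one (Nat.cast_pos.2 hN)]
    exact Nat.cast_le.2 ((card_filter_le _ _).trans_eq (card_range N))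

/-- `log q_n`. -/
noncomputable def logq (n : ℕ) : ℝ := Real.log (Qs n)

variable (S) in
/-- The logarithm of the number of admissible digits at position `n`. -/
noncomputable def logw (n : ℕ) : ℝ := Real.log (width S n)

lemma width_le_Qs (n : ℕ) : width S n ≤ Qs n := by
  have h1 := wid_st_le_Qs n
  have h2 := wid_pos (st n)
  unfold width
  split_ifs <;> omega

lemma logw_nonneg (n : ℕ) : 0 ≤ logw S n := Real.log_nonneg (Nat.one_le_cast.2 (width_pos n))

lemma logw_le_logq (n : ℕ) : logw S n ≤ logq n :=
  Real.log_le_log (Nat.cast_pos.2 (width_pos n)) (Nat.cast_le.2 (width_le_Qs n))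

lemma logq_le (n : ℕ) : logq n ≤ Qs n := Real.log_le_self (Qs_pos n).le

lemma adm_logq : Adm logq := fun n => ⟨(logw_nonneg (S := ∅) n).trans (logw_le_logq n), logq_le n⟩

lemma adm_logq_sub_logw : Adm fun n => logq n - logw S n := fun n =>
  ⟨sub_nonneg.2 (logw_le_logq n), (sub_le_self _ (logw_nonneg n)).trans (logq_le n)⟩

lemma one_le_log_base (t : ℕ) : 1 ≤ Real.log (base t) := by
  rw [Real.le_log_iff_exp_le (Nat.cast_pos.2 (base_pos t))]
  have h1 : (32 : ℝ) ≤ base t := by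
    have h1 := alph_le_base t
    have h2 := two_le_alph t
    exact_mod_cast (by omega : 32 ≤ base t)
  have := Real.exp_one_lt_d9
  linarith

lemma psum_logq (u : ℕ) : psum logq u = plen (stage u) * Real.log (base (stage u)) := by
  have h1 : ∀ o ∈ range (plen (stage u)), logq (start u + o) = Real.log (base (stage u)) := by
    intro o ho
    rw [logq, Qs, st_start_add (mem_range.1 ho)]
  rw [psum, sum_congr rfl h1, sum_const, card_range, nsmul_eq_mul]

lemma one_le_psum_logq (u : ℕ) : 1 ≤ psum logq u := by
  rw [psum_logq]
  exact one_le_mul_of_one_le_of_one_le (Nat.one_le_cast.2 (plen_pos _)) (one_le_log_base _)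

lemma log_base (t : ℕ) : Real.log (base t) = Real.log (expo t) + Real.log (wid t) := by
  have h1 : expo t ≠ 0 := by
    have := alph_le_expo t
    have := two_le_alph t
    omega
  rw [base, Nat.cast_mul, Real.log_mul (Nat.cast_ne_zero.2 h1)
    (Nat.cast_ne_zero.2 (wid_pos t).ne')]

lemma psum_logq_sub_logw_le (u : ℕ) : psum (fun n => logq n - logw S n) u
    ≤ Real.log (base (stage u)) * psum (ind fun i => dg S i ≠ none) u
      + plen (stage u) * Real.log (expo (stage u)) := by
  have h1 : ∀ o ∈ range (plen (stage u)), logq (start u + o) - logw S (start u + o)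
      ≤ Real.log (base (stage u)) * ind (fun i => dg S i ≠ none) (start u + o)
        + Real.log (expo (stage u)) := by
    intro o ho
    have h2 := st_start_add (mem_range.1 ho)
    have h3 := log_base (stage u)
    have h4 : 0 ≤ Real.log (expo (stage u)) := Real.log_natCast_nonneg _
    rw [logq, Qs, logw, width, h2, ind]
    by_cases h : dg S (start u + o) = none
    · simp only [h, if_true, ne_eq, not_true_eq_false, if_false]
      linarith
    · simp only [h, if_false, ne_eq, not_false_eq_true, if_true, Nat.cast_one, Real.log_one]
      linarith
  refine (sum_le_sum h1).trans_eq ?_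
  rw [sum_add_distrib, ← mul_sum, sum_const, card_range, nsmul_eq_mul]
  rfl

lemma eventually_log_expo_le {c : ℝ} (hc : 0 < c) :
    ∀ᶠ u in atTop, Real.log (expo (stage u)) ≤ c * Real.log (base (stage u)) := by
  have h1 : Tendsto (fun u => (expo (stage u) : ℝ)) atTop atTop := by
    refine tendsto_natCast_atTop_atTop.comp (tendsto_atTop_mono (fun u => ?_) tendsto_stage)
    have := alph_le_expo (stage u)
    unfold alph at this
    omega
  have h2 := (Real.isLittleO_log_id_atTop.comp_tendsto h1).def (half_pos hc)
  filter_upwards [h2] with u hu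
  have h3 : 0 ≤ Real.log (expo (stage u)) := Real.log_natCast_nonneg _
  simp only [Function.comp, id] at hu
  rw [Real.norm_natCast, Real.norm_of_nonneg h3] at hu
  have h4 : Real.log (wid (stage u)) = expo (stage u) * Real.log 2 := by
    rw [wid, Nat.cast_pow, Real.log_pow, Nat.cast_ofNat]
  have h5 := Real.log_two_gt_d9
  rw [log_base, h4]
  have h6 : (0 : ℝ) ≤ expo (stage u) := Nat.cast_nonneg _
  have h7 : (expo (stage u) : ℝ) * (1 / 2) ≤ expo (stage u) * Real.log 2 :=
    mul_le_mul_of_nonneg_left (by linarith) h6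
  have h8 := mul_le_mul_of_nonneg_left h7 hc.le
  have h9 := mul_nonneg hc.le h3
  linarith

lemma sum_logq_sub_logw_isLittleO :
    (fun n => ∑ i ∈ range n, (logq i - logw S i)) =o[atTop] fun n => ∑ i ∈ range n, logq i := by
  have h := sum_sub_isLittleO (adm_logq_sub_logw (S := S)) adm_logq
    (Eventually.of_forall one_le_psum_logq) 0 ?_
  · simpa only [zero_mul, sub_zero] using h
  refine Asymptotics.isLittleO_iff.2 fun c hc => ?_
  filter_upwards [eventually_psum_special_le (S := S) (half_pos hc),
    eventually_log_expo_le (half_pos hc)] with u h1 h2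
  have h3 := psum_logq_sub_logw_le (S := S) u
  have h4 : 0 ≤ psum (fun n => logq n - logw S n) u :=
    sum_nonneg fun i _ => (adm_logq_sub_logw _).1
  have h5 := one_le_log_base (stage u)
  rw [zero_mul, sub_zero, Real.norm_of_nonneg h4,
    Real.norm_of_nonneg (zero_le_one.trans (one_le_psum_logq u)), psum_logq]
  have h6 := mul_le_mul_of_nonneg_left h1 (zero_le_one.trans h5)
  have h7 := mul_le_mul_of_nonneg_left h2 (Nat.cast_nonneg (α := ℝ) (plen (stage u)))
  linarith

lemma exists_add_const_le {a b : ℕ → ℝ} (h : ∀ᶠ n in atTop, a n ≤ b n) :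
    ∃ C : ℝ, ∀ n, a n ≤ b n + C := by
  obtain ⟨N, hN⟩ := eventually_atTop.1 h
  refine ⟨∑ i ∈ range N, |a i - b i|, fun n => ?_⟩
  have h0 : 0 ≤ ∑ i ∈ range N, |a i - b i| := sum_nonneg fun i _ => abs_nonneg _
  rcases le_or_gt N n with hn | hn
  · linarith [hN n hn]
  · have h1 := single_le_sum (f := fun i => |a i - b i|) (fun i _ => abs_nonneg _)
      (mem_range.2 hn)
    have h2 := le_abs_self (a n - b n)
    linarith

lemma eventually_logq_le {ε : ℝ} (hε : 0 < ε) :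
    ∀ᶠ n in atTop, logq n ≤ ε * ∑ i ∈ range n, logq i := by
  have h := (partial_isLittleO_sum adm_logq (Eventually.of_forall one_le_psum_logq)).def hε
  filter_upwards [h] with n hn
  rw [Real.norm_natCast,
    Real.norm_of_nonneg (sum_nonneg fun i _ => (adm_logq i).1)] at hn
  refine ((logq_le n).trans ?_).trans hn
  exact Nat.cast_le.2 (Nat.le_mul_of_pos_left _ (plen_pos _))

variable (S) in
lemma exists_log_bound {r : ℝ} (hr1 : r < 1) :
    ∃ C : ℝ, ∀ n, r * ∑ i ∈ range (n + 2), logq i ≤ ∑ i ∈ range n, logw S i + C := by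
  refine exists_add_const_le ?_
  have hε : 0 < (1 - r) / 4 := by linarith
  have h1 := eventually_logq_le hε
  filter_upwards [h1, (tendsto_add_atTop_nat 1).eventually h1,
    (sum_logq_sub_logw_isLittleO (S := S)).def hε] with n h2 h3 h4
  have hG : 0 ≤ ∑ i ∈ range n, logq i := sum_nonneg fun i _ => (adm_logq i).1
  rw [Real.norm_of_nonneg (sum_nonneg fun i _ => (adm_logq_sub_logw i).1),
    Real.norm_of_nonneg hG, sum_sub_distrib] at h4
  rw [sum_range_succ] at h3
  rw [sum_range_succ, sum_range_succ]
  have h5 := (adm_logq n).1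
  have h6 := (adm_logq (n + 1)).1
  nlinarith

lemma qprod_Qs (n : ℕ) : qprod Qs n = Real.exp (∑ i ∈ range n, logq i) := by
  rw [Real.exp_sum]
  exact prod_congr rfl fun i _ => (Real.exp_log (Qs_pos i)).symm

lemma qprod_width (n : ℕ) : qprod (width S) n = Real.exp (∑ i ∈ range n, logw S i) := by
  rw [Real.exp_sum]
  exact prod_congr rfl fun i _ => (Real.exp_log (Nat.cast_pos.2 (width_pos i))).symm

lemma abs_sub_le_point_rpow (xs : ℕ → ℝ) {r C : ℝ} (hr0 : 0 < r)
    (hC : ∀ n, r * ∑ i ∈ range (n + 2), logq i ≤ ∑ i ∈ range n, logw S i + C)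
    {z z' : ℝ} (hz : z ∈ Set.Ico (0 : ℝ) 1) (hz' : z' ∈ Set.Ico (0 : ℝ) 1) :
    |z - z'| ≤ Real.exp C * |point S xs z - point S xs z'| ^ r := by
  have hbound : ∀ n, 1 / qprod (width S) n ≤ Real.exp C * (1 / qprod Qs (n + 2)) ^ r := by
    intro n
    rw [qprod_width, qprod_Qs, one_div, one_div, ← Real.exp_neg, ← Real.exp_neg,
      ← Real.exp_mul, ← Real.exp_add, Real.exp_le_exp]
    linarith [hC n]
  by_cases h : ∀ n, qdigit (width S) z n = qdigit (width S) z' n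
  · have h1 : ∀ n, |z - z'| ≤ Real.exp C * Real.exp (-(r * ∑ i ∈ range (n + 2), logq i)) := by
      intro n
      refine (abs_sub_le_of_digits_eq width_pos hz hz' fun i _ => h i).trans ((hbound n).trans_eq ?_)
      rw [qprod_Qs, one_div, ← Real.exp_neg, ← Real.exp_mul]
      ring_nf
    have h2 : Tendsto (fun n => ∑ i ∈ range (n + 2), logq i) atTop atTop :=
      (tendsto_sum_atTop adm_logq (Eventually.of_forall one_le_psum_logq)).comp
        (tendsto_add_atTop_nat 2)
    have h3 := (Real.tendsto_exp_neg_atTop_nhds_zero.comp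
      (h2.const_mul_atTop hr0)).const_mul (Real.exp C)
    have h4 := ge_of_tendsto' h3 h1
    rw [mul_zero] at h4
    refine h4.trans (mul_nonneg (Real.exp_pos C).le (Real.rpow_nonneg (abs_nonneg _) r))
  · push Not at h
    have hn := Nat.find_spec h
    have hlt : ∀ i < Nat.find h, qdigit (width S) z i = qdigit (width S) z' i :=
      fun i hi => not_not.1 (Nat.find_min h hi)
    set n := Nat.find h
    refine (abs_sub_le_of_digits_eq width_pos hz hz' hlt).trans ((hbound n).trans ?_)
    refine mul_le_mul_of_nonneg_left (Real.rpow_le_rpow ?_ ?_ hr0.le) (Real.exp_pos C).le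
    · exact one_div_nonneg.2 (prod_nonneg fun i _ => Nat.cast_nonneg _)
    · refine le_abs_cval_sub (isDigits_digit xs z) (isDigits_digit xs z') (fun i hi => ?_) ?_
      · rw [digit, digit, hlt i hi]
      · rw [digit, digit]; omega

open scoped NNReal in
lemma le_dimH_of_abs_sub_le {Y : ℝ → ℝ} {s : Set ℝ} {r C : ℝ≥0} (hr : 0 < r)
    (h : ∀ z ∈ s, ∀ z' ∈ s, |z - z'| ≤ C * |Y z - Y z'| ^ (r : ℝ)) :
    r * dimH s ≤ dimH (Y '' s) := by
  have hinj : Set.InjOn Y s := fun z hz z' hz' he => by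
    have := h z hz z' hz'
    rw [he, sub_self, abs_zero, Real.zero_rpow (NNReal.coe_pos.2 hr).ne', mul_zero] at this
    exact sub_eq_zero.1 (abs_eq_zero.1 (le_antisymm this (abs_nonneg _)))
  have hH : HolderOnWith C r (Function.invFunOn Y s) (Y '' s) := by
    rintro _ ⟨z, hz, rfl⟩ _ ⟨z', hz', rfl⟩
    rw [hinj.leftInvOn_invFunOn hz, hinj.leftInvOn_invFunOn hz', edist_dist, edist_dist,
      ENNReal.ofReal_rpow_of_nonneg dist_nonneg r.coe_nonneg, ← ENNReal.ofReal_coe_nnreal,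
      ← ENNReal.ofReal_mul C.coe_nonneg]
    exact ENNReal.ofReal_le_ofReal (h z hz z' hz')
  have h1 := hH.dimH_image_le hr
  rw [(hinj.leftInvOn_invFunOn).image_image] at h1
  rw [ENNReal.le_div_iff_mul_le (Or.inl (by simpa using hr.ne')) (Or.inl ENNReal.coe_ne_top)] at h1
  rwa [mul_comm]

lemma dimH_image_point (xs : ℕ → ℝ) : 1 ≤ dimH (point S xs '' Set.Ico 0 1) := by
  have hI : dimH (Set.Ico (0 : ℝ) 1) = 1 := by
    have := Real.dimH_of_nonempty_interior
      ((interior_Ico (a := (0 : ℝ)) (b := 1)).symm ▸ Set.nonempty_Ioo.2 one_pos)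
    simpa using this
  refine ENNReal.le_of_forall_nnreal_lt fun r hr => ?_
  rcases eq_or_ne r 0 with rfl | hr0
  · exact zero_le
  have hr0 : 0 < r := pos_iff_ne_zero.2 hr0
  have hr1 : (r : ℝ) < 1 := by exact_mod_cast hr
  obtain ⟨C, hC⟩ := exists_log_bound S hr1
  have h := le_dimH_of_abs_sub_le (Y := point S xs) (s := Set.Ico 0 1) (r := r)
    (C := ⟨Real.exp C, (Real.exp_pos C).le⟩) hr0 fun z hz z' hz' =>
    abs_sub_le_point_rpow xs (NNReal.coe_pos.2 hr0) hC hz hz'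
  rwa [hI, mul_one] at h

end CantorConstruction

open CantorConstruction

/-- If `S` is almost closed under addition, then there exists a fully divergent, infinite
in limit basic sequence `Q` such that for every sequence `(x_n)` in `[0,1)`,
`dim_H(D_{(x_n)}(Q) ∩ RN^{I}(Q) ∩ RN^{II}(Q) ∩ N^{I}_{Ab}(Q) ∩ ⋂_{k∈S} N_k(Q)
  \ (N^{II}(Q) ∪ ⋃_{k∉S} N_k(Q))) = 1`. -/
theorem stmt6 (S : Set ℕ) (hSpos : 0 ∉ S) (hS : AlmostClosed S) :
    ∃ Q : ℕ → ℕ, IsBasic Q ∧ FullyDivergent Q ∧ InfiniteInLimit Q ∧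
      ∀ xs : ℕ → ℝ, (∀ n, xs n ∈ Set.Ico (0 : ℝ) 1) →
        dimH (({y : ℝ | MemD Q xs y} ∩ {y : ℝ | MemRNI Q y} ∩ {y : ℝ | MemRNII Q y} ∩
          {y : ℝ | APAbnormalI Q y} ∩ (⋂ k ∈ S, {y : ℝ | QNormalOfOrder Q k y})) \
          ({y : ℝ | APNormalII Q y} ∪
            ⋃ k ∈ {k : ℕ | 1 ≤ k ∧ k ∉ S}, {y : ℝ | QNormalOfOrder Q k y})) = 1 := by
  refine ⟨Qs, Qs_basic, fullyDivergent_Qs, tendsto_Qs, fun xs hxs =>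
    le_antisymm ((dimH_mono (Set.subset_univ _)).trans_eq Real.dimH_univ)
      ((dimH_image_point (S := S) xs).trans (dimH_mono ?_))⟩
  rintro _ ⟨z, -, rfl⟩
  have hE := follows_digit (S := S) xs z
  have hd := isDigits_digit (S := S) xs z
  refine ⟨⟨⟨⟨⟨memD_point hxs z, memRNI_cval hE hd⟩, memRNII_cval hE hd⟩,
    apAbnormalI_cval hE hd⟩, Set.mem_iInter₂.2 fun k hk => ?_⟩, ?_⟩
  · exact qNormalOfOrder_cval hE hd (Nat.pos_of_ne_zero (ne_of_mem_of_not_mem hk hSpos)) hk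
  · rintro (h | h)
    · exact not_apNormalII_cval hE hd h
    · obtain ⟨k, ⟨hk1, hk2⟩, hk3⟩ := Set.mem_iUnion₂.1 h
      exact not_qNormalOfOrder_cval hE hd hk1 hk2 hk3
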